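/- arXiv:1811.05593 — 2 statements merged into one kernel-verified Lean document; each statement's English description precedes it below -/
import Mathlib

section
/- Let (H,R) be a quasi-triangular Hopf algebra over a field k. A subspace D ⊆ H is a minimal (nonzero) Yetter-Drinfeld submodule of H (for the left adjoint action ·_ad and the coproduct Δ) if and only if D is a minimal H-adjoint-stable subcoalgebra of the transmuted braided group H_R, i.e. a minimal nonzero subcoalgebra of H_R satisfying H ·_ad D ⊆ D. -/
open TensorProduct LinearMap

variable (K : Type) [Field K] (H : Type) [Ring H] [HopfAlgebra K H]

/-- The left adjoint action as a linear map `H ⊗ H →ₗ H`, `h ⊗ a ↦ Σ h₍₁₎ * a * S(h₍₂₎)`. -/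
noncomputable def adMap : H ⊗[K] H →ₗ[K] H :=
  (LinearMap.mul' K H) ∘ₗ
    (LinearMap.lTensor H ((LinearMap.mul' K H) ∘ₗ
      (LinearMap.lTensor H (HopfAlgebra.antipode (R := K))) ∘ₗ
      (TensorProduct.comm K H H).toLinearMap)) ∘ₗ
    (TensorProduct.assoc K H H H).toLinearMap ∘ₗ
    (LinearMap.rTensor H (Coalgebra.comul (R := K)))

/-- `h ·_ad a = Σ h₍₁₎ a S(h₍₂₎)`. -/
noncomputable def adAct (h a : H) : H := adMap K H (h ⊗ₜ a)

/-- `R¹² = Σ r¹ ⊗ r² ⊗ 1` in `H ⊗ (H ⊗ H)`. -/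
noncomputable def r12 (R : H ⊗[K] H) : H ⊗[K] (H ⊗[K] H) :=
  TensorProduct.map LinearMap.id ((TensorProduct.mk K H H).flip 1) R

/-- `R¹³ = Σ r¹ ⊗ 1 ⊗ r²` in `H ⊗ (H ⊗ H)`. -/
noncomputable def r13 (R : H ⊗[K] H) : H ⊗[K] (H ⊗[K] H) :=
  TensorProduct.map LinearMap.id (TensorProduct.mk K H H 1) R

/-- `R²³ = 1 ⊗ R` in `H ⊗ (H ⊗ H)`. -/
noncomputable def r23 (R : H ⊗[K] H) : H ⊗[K] (H ⊗[K] H) := (1 : H) ⊗ₜ R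

/-- `(H,R)` is a quasi-triangular Hopf algebra: `R` is invertible,
`R Δ(h) = Δᶜᵒᵖ(h) R`, `(Δ⊗id)(R) = R¹³R²³` and `(id⊗Δ)(R) = R¹³R¹²`. -/
structure IsQuasiTriangular (R : H ⊗[K] H) : Prop where
  isUnit : IsUnit R
  intertwine : ∀ h : H, R * Coalgebra.comul h =
    (TensorProduct.comm K H H) (Coalgebra.comul h) * R
  comul_rTensor : (TensorProduct.assoc K H H H)
      ((LinearMap.rTensor H (Coalgebra.comul (R := K))) R) = r13 K H R * r23 K H R
  comul_lTensor : (LinearMap.lTensor H (Coalgebra.comul (R := K))) R = r13 K H R * r12 K H R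

/-- The comultiplication `Δ_R` of the transmuted braided group `H_R`:
`Δ_R(h) = Σ h₍₁₎ S(R²) ⊗ R¹ ·_ad h₍₂₎`. -/
noncomputable def deltaR (R : H ⊗[K] H) : H →ₗ[K] H ⊗[K] H :=
  (TensorProduct.map
      ((LinearMap.mul' K H) ∘ₗ (LinearMap.lTensor H (HopfAlgebra.antipode (R := K))))
      ((adMap K H) ∘ₗ (TensorProduct.comm K H H).toLinearMap)) ∘ₗ
    (TensorProduct.tensorTensorTensorComm K H H H H).toLinearMap ∘ₗ
    (LinearMap.lTensor (H ⊗[K] H) (TensorProduct.comm K H H).toLinearMap) ∘ₗ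
    ((TensorProduct.mk K (H ⊗[K] H) (H ⊗[K] H)).flip R) ∘ₗ
    (Coalgebra.comul (R := K))

/-- A Yetter–Drinfeld submodule of `H` (with the adjoint action and the coproduct):
a subspace stable under `·_ad` and a left subcomodule for `Δ`, i.e. `Δ(D) ⊆ H ⊗ D`. -/
def IsYDSubmodule (D : Submodule K H) : Prop :=
  (∀ (h : H), ∀ a ∈ D, adAct K H h a ∈ D) ∧
  (∀ a ∈ D, Coalgebra.comul (R := K) a ∈ Submodule.map₂ (TensorProduct.mk K H H) ⊤ D)

/-- A minimal (nonzero) Yetter–Drinfeld submodule of `H`. -/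
def IsMinimalYDSubmodule (D : Submodule K H) : Prop :=
  D ≠ ⊥ ∧ IsYDSubmodule K H D ∧
    ∀ D' : Submodule K H, D' ≤ D → IsYDSubmodule K H D' → D' = ⊥ ∨ D' = D

/-- An `H`-adjoint-stable subcoalgebra of the transmuted braided group `H_R`:
a subcoalgebra of `(H, Δ_R)` which is stable under the left adjoint action. -/
def IsAdjointStableSubcoalgebra (R : H ⊗[K] H) (D : Submodule K H) : Prop :=
  (∀ (h : H), ∀ a ∈ D, adAct K H h a ∈ D) ∧
  (∀ a ∈ D, deltaR K H R a ∈ Submodule.map₂ (TensorProduct.mk K H H) D D)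

/-- A minimal (nonzero) `H`-adjoint-stable subcoalgebra of `H_R`. -/
def IsMinimalAdjointStableSubcoalgebra (R : H ⊗[K] H) (D : Submodule K H) : Prop :=
  D ≠ ⊥ ∧ IsAdjointStableSubcoalgebra K H R D ∧
    ∀ D' : Submodule K H, D' ≤ D → IsAdjointStableSubcoalgebra K H R D' → D' = ⊥ ∨ D' = D

section Quasitriangular

open Coalgebra HopfAlgebra

variable {K H}

theorem adAct_eq (h a : H) :
    adAct K H h a = mul' K H (map (mulRight K a) (antipode K) (comul h)) := by
  unfold adAct adMap
  simp only [LinearMap.comp_apply, rTensor_tmul, LinearEquiv.coe_coe]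
  generalize (comul h : H ⊗[K] H) = t
  induction t with
  | zero => simp
  | add x y hx hy => simp only [add_tmul, map_add, hx, hy]
  | tmul x y => simp [mul_assoc]

theorem adAct_mul (g h a : H) : adAct K H (g * h) a = adAct K H g (adAct K H h a) := by
  simp only [adAct_eq, Bialgebra.comul_mul]
  obtain ⟨s, hs⟩ := TensorProduct.exists_finset (comul g : H ⊗[K] H)
  obtain ⟨t, ht⟩ := TensorProduct.exists_finset (comul h : H ⊗[K] H)
  simp [hs, ht, Finset.sum_mul, Finset.mul_sum, antipode_mul_antidistrib, mul_assoc]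
  rw [Finset.sum_comm]

theorem adAct_one (a : H) : adAct K H 1 a = a := by
  simp [adAct_eq, Algebra.TensorProduct.one_def]

theorem deltaR_sum_tmul (s t : Finset (H × H)) (h : H)
    (ht : comul h = ∑ k ∈ t, k.1 ⊗ₜ[K] k.2) :
    deltaR K H (∑ i ∈ s, i.1 ⊗ₜ i.2) h =
      ∑ k ∈ t, ∑ i ∈ s, (k.1 * antipode K i.2) ⊗ₜ[K] adAct K H i.1 k.2 := by
  rw [Finset.sum_comm]
  simp [deltaR, ht, adAct]

theorem tmul_tmul_sum_of_comul_rTensor {s : Finset (H × H)}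
    (hs : IsQuasiTriangular K H (∑ i ∈ s, i.1 ⊗ₜ i.2)) :
    ∑ i ∈ s, (comul i.1 : H ⊗[K] H) ⊗ₜ[K] i.2 =
      ∑ i ∈ s, ∑ j ∈ s, (i.1 ⊗ₜ j.1) ⊗ₜ (i.2 * j.2) := by
  apply (TensorProduct.assoc K H H H).injective
  simpa [r13, r23, Finset.sum_mul_sum, tmul_sum] using hs.comul_rTensor

theorem tmul_tmul_sum_of_comul_lTensor {s : Finset (H × H)}
    (hs : IsQuasiTriangular K H (∑ i ∈ s, i.1 ⊗ₜ i.2)) :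
    ∑ i ∈ s, i.1 ⊗ₜ[K] (comul i.2 : H ⊗[K] H) =
      ∑ i ∈ s, ∑ j ∈ s, (i.1 * j.1) ⊗ₜ (j.2 ⊗ₜ i.2) := by
  simpa [r13, r12, Finset.sum_mul_sum] using hs.comul_lTensor

theorem sum_counit_smul_right {s : Finset (H × H)}
    (hs : IsQuasiTriangular K H (∑ i ∈ s, i.1 ⊗ₜ i.2)) :
    ∑ i ∈ s, counit (R := K) i.1 • i.2 = 1 := by
  have h := congrArg (rTensor H ((TensorProduct.lid K H).toLinearMap ∘ₗ rTensor H counit))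
    (tmul_tmul_sum_of_comul_rTensor hs)
  have h' : (1 ⊗ₜ[K] (∑ i ∈ s, counit (R := K) i.1 • i.2)) * (∑ i ∈ s, i.1 ⊗ₜ i.2) =
      ∑ i ∈ s, i.1 ⊗ₜ[K] i.2 := by
    simpa [Finset.sum_mul_sum, tmul_sum, smul_tmul] using h.symm
  have h1 := hs.isUnit.mul_eq_right.mp h'
  simpa [Algebra.TensorProduct.one_def] using congrArg (mul' K H) h1

theorem sum_counit_smul_left {s : Finset (H × H)}
    (hs : IsQuasiTriangular K H (∑ i ∈ s, i.1 ⊗ₜ i.2)) :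
    ∑ i ∈ s, counit (R := K) i.2 • i.1 = 1 := by
  have h := congrArg (lTensor H ((TensorProduct.lid K H).toLinearMap ∘ₗ rTensor H counit))
    (tmul_tmul_sum_of_comul_lTensor hs)
  have h' : (∑ i ∈ s, i.1 ⊗ₜ i.2) * ((∑ i ∈ s, counit (R := K) i.2 • i.1) ⊗ₜ[K] 1) =
      ∑ i ∈ s, i.1 ⊗ₜ[K] i.2 := by
    simpa [Finset.sum_mul_sum, sum_tmul, ← smul_tmul'] using h.symm
  have h1 := hs.isUnit.mul_eq_left.mp h'
  simpa [Algebra.TensorProduct.one_def] using congrArg (mul' K H) h1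

theorem sum_antipode_mul_tmul_mul {s : Finset (H × H)}
    (hs : IsQuasiTriangular K H (∑ i ∈ s, i.1 ⊗ₜ i.2)) :
    ∑ i ∈ s, ∑ j ∈ s, (antipode K i.1 * j.1) ⊗ₜ[K] (i.2 * j.2) = 1 := by
  have h := congrArg (rTensor H (mul' K H ∘ₗ rTensor H (antipode K)))
    (tmul_tmul_sum_of_comul_rTensor hs)
  simp only [map_sum, rTensor_tmul, LinearMap.comp_apply, mul'_apply,
    mul_antipode_rTensor_comul_apply, Algebra.algebraMap_eq_smul_one, smul_tmul] at h
  rw [← h, ← tmul_sum, sum_counit_smul_right hs, Algebra.TensorProduct.one_def]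

theorem sum_mul_tmul_antipode_mul {s : Finset (H × H)}
    (hs : IsQuasiTriangular K H (∑ i ∈ s, i.1 ⊗ₜ i.2)) :
    ∑ i ∈ s, ∑ j ∈ s, (i.1 * j.1) ⊗ₜ[K] (antipode K j.2 * i.2) = 1 := by
  have h := congrArg (lTensor H (mul' K H ∘ₗ rTensor H (antipode K)))
    (tmul_tmul_sum_of_comul_lTensor hs)
  simp only [map_sum, lTensor_tmul, rTensor_tmul, LinearMap.comp_apply, mul'_apply,
    mul_antipode_rTensor_comul_apply, Algebra.algebraMap_eq_smul_one, ← smul_tmul] at h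
  rw [← h, ← sum_tmul, sum_counit_smul_left hs, Algebra.TensorProduct.one_def]

/-- The antipode preserves a universal R-matrix: `(S ⊗ S)(R) = R`. -/
theorem sum_antipode_tmul_antipode {s : Finset (H × H)}
    (hs : IsQuasiTriangular K H (∑ i ∈ s, i.1 ⊗ₜ i.2)) :
    ∑ i ∈ s, antipode K i.1 ⊗ₜ[K] antipode K i.2 = ∑ i ∈ s, i.1 ⊗ₜ i.2 := by
  refine left_inv_eq_right_inv (a := ∑ i ∈ s, antipode K i.1 ⊗ₜ[K] i.2) ?_ ?_
  · have h := congrArg (rTensor H (antipode K)) (sum_mul_tmul_antipode_mul hs)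
    rw [Finset.sum_comm] at h
    simpa [Finset.sum_mul_sum, antipode_mul_antidistrib,
      Algebra.TensorProduct.one_def] using h
  · simpa [Finset.sum_mul_sum] using sum_antipode_mul_tmul_mul hs

/-- The coproduct of `H` is recovered from that of `H_R`: writing `Δ_R(h) = Σ h₍₁₎ ⊗ h₍₂₎`,
one has `Δ(h) = Σ h₍₁₎ r² ⊗ r¹ ·_ad h₍₂₎`. -/
theorem comul_eq_sum_deltaR {s : Finset (H × H)}
    (hs : IsQuasiTriangular K H (∑ i ∈ s, i.1 ⊗ₜ i.2)) (h : H) :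
    comul h = ∑ j ∈ s, map (mulRight K j.2) (adMap K H ∘ₗ TensorProduct.mk K H H j.1)
      (deltaR K H (∑ i ∈ s, i.1 ⊗ₜ i.2) h) := by
  obtain ⟨t, ht⟩ := TensorProduct.exists_finset (comul h : H ⊗[K] H)
  rw [deltaR_sum_tmul s t h ht, ht]
  simp only [map_sum, map_tmul, mulRight_apply, LinearMap.comp_apply, TensorProduct.mk_apply]
  rw [Finset.sum_comm]
  refine Finset.sum_congr rfl fun k _ => ?_
  let F : H ⊗[K] H →ₗ[K] H ⊗[K] H := (TensorProduct.comm K H H).toLinearMap ∘ₗ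
    map (adMap K H ∘ₗ (TensorProduct.mk K H H).flip k.2) (mulLeft K k.1)
  have e := congrArg F (sum_mul_tmul_antipode_mul hs)
  have one : F 1 = k.1 ⊗ₜ k.2 := by
    have := adAct_one (K := K) k.2
    simp_all [F, Algebra.TensorProduct.one_def, adAct]
  rw [one] at e
  rw [← e]
  simp only [F, map_sum, LinearMap.comp_apply, LinearEquiv.coe_coe, map_tmul, comm_tmul,
    mulLeft_apply, flip_apply, TensorProduct.mk_apply]
  refine Finset.sum_congr rfl fun i _ => Finset.sum_congr rfl fun j _ => ?_
  congr 1
  · rw [mul_assoc]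
  · exact adAct_mul i.1 j.1 k.2

/-- Braided cocommutativity of `H_R`: `Δ_R(h) = Σ r² ·_ad h₍₂₎ ⊗ r¹ h₍₁₎`. -/
theorem deltaR_eq_sum_adAct {s t : Finset (H × H)}
    (hs : IsQuasiTriangular K H (∑ i ∈ s, i.1 ⊗ₜ i.2)) (h : H)
    (ht : comul h = ∑ k ∈ t, k.1 ⊗ₜ[K] k.2) :
    deltaR K H (∑ i ∈ s, i.1 ⊗ₜ i.2) h =
      ∑ k ∈ t, ∑ i ∈ s, adAct K H i.2 k.2 ⊗ₜ[K] (i.1 * k.1) := by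
  calc deltaR K H (∑ i ∈ s, i.1 ⊗ₜ i.2) h
      = ∑ k ∈ t, ∑ i ∈ s, ∑ j ∈ s, (k.1 * (antipode K j.2 * antipode K i.2)) ⊗ₜ[K]
          (i.1 * k.2 * antipode K j.1) := by
        rw [deltaR_sum_tmul s t h ht]
        refine Finset.sum_congr rfl fun k _ => ?_
        have e := congrArg ((TensorProduct.comm K H H).toLinearMap ∘ₗ
            map (mul' K H ∘ₗ map (mulRight K k.2) (antipode K)) (mulLeft K k.1 ∘ₗ antipode K))
          (tmul_tmul_sum_of_comul_rTensor hs)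
        simpa [← adAct_eq, antipode_mul_antidistrib] using e
    _ = ∑ k ∈ t, ∑ i ∈ s, ∑ j ∈ s, (k.1 * (j.2 * antipode K i.2)) ⊗ₜ[K] (i.1 * k.2 * j.1) := by
        refine Finset.sum_congr rfl fun k _ => Finset.sum_congr rfl fun i _ => ?_
        have e := congrArg ((TensorProduct.comm K H H).toLinearMap ∘ₗ
            map (mulLeft K (i.1 * k.2)) (mulLeft K k.1 ∘ₗ mulRight K (antipode K i.2)))
          (sum_antipode_tmul_antipode hs)
        simpa [mul_assoc] using e
    _ = ∑ i ∈ s, ∑ k ∈ t, ∑ j ∈ s, (j.2 * k.2 * antipode K i.2) ⊗ₜ[K] (i.1 * (j.1 * k.1)) := by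
        rw [Finset.sum_comm]
        refine Finset.sum_congr rfl fun i _ => ?_
        have e := congrArg ((TensorProduct.comm K H H).toLinearMap ∘ₗ
            map (mulLeft K i.1) (mulRight K (antipode K i.2))) (hs.intertwine h)
        rw [ht, Finset.sum_mul_sum, Finset.sum_comm] at e
        simpa [Finset.sum_mul_sum, mul_assoc] using e.symm
    _ = ∑ k ∈ t, ∑ i ∈ s, adAct K H i.2 k.2 ⊗ₜ[K] (i.1 * k.1) := by
        rw [Finset.sum_comm]
        refine Finset.sum_congr rfl fun k _ => ?_
        have e := congrArg ((TensorProduct.comm K H H).toLinearMap ∘ₗ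
            map (mulRight K k.1) (mul' K H ∘ₗ map (mulRight K k.2) (antipode K)))
          (tmul_tmul_sum_of_comul_lTensor hs)
        simpa [← adAct_eq, mul_assoc] using e.symm

theorem map_mem_map₂_mk {V : Type*} [AddCommGroup V] [Module K V] {P Q P' Q' : Submodule K V}
    {f g : V →ₗ[K] V} (hf : ∀ x ∈ P, f x ∈ P') (hg : ∀ x ∈ Q, g x ∈ Q') {z : V ⊗[K] V}
    (hz : z ∈ Submodule.map₂ (TensorProduct.mk K V V) P Q) :
    map f g z ∈ Submodule.map₂ (TensorProduct.mk K V V) P' Q' := by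
  suffices Submodule.map₂ (TensorProduct.mk K V V) P Q ≤
      (Submodule.map₂ (TensorProduct.mk K V V) P' Q').comap (map f g) from this hz
  exact Submodule.map₂_le.mpr fun x hx y hy =>
    Submodule.apply_mem_map₂ _ (hf x hx) (hg y hy)

theorem map_eq_self_of_mem_map₂_mk {V : Type*} [AddCommGroup V] [Module K V]
    {P Q : Submodule K V} {f g : V →ₗ[K] V} (hf : ∀ x ∈ P, f x = x) (hg : ∀ x ∈ Q, g x = x)
    {z : V ⊗[K] V} (hz : z ∈ Submodule.map₂ (TensorProduct.mk K V V) P Q) :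
    map f g z = z := by
  suffices Submodule.map₂ (TensorProduct.mk K V V) P Q ≤ eqLocus (map f g) LinearMap.id from this hz
  exact Submodule.map₂_le.mpr fun x hx y hy => by simp [hf x hx, hg y hy]

/-- Over a field, `(D ⊗ V) ∩ (V ⊗ D) = D ⊗ D`. -/
theorem mem_map₂_mk_self {V : Type*} [AddCommGroup V] [Module K V] {D : Submodule K V}
    {z : V ⊗[K] V} (hl : z ∈ Submodule.map₂ (TensorProduct.mk K V V) D ⊤)
    (hr : z ∈ Submodule.map₂ (TensorProduct.mk K V V) ⊤ D) :
    z ∈ Submodule.map₂ (TensorProduct.mk K V V) D D := by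
  obtain ⟨p, hp⟩ := D.subtype.exists_leftInverse_of_injective D.ker_subtype
  have hq : ∀ x ∈ D, (D.subtype ∘ₗ p) x = x := fun x hx =>
    congrArg Subtype.val (LinearMap.congr_fun hp ⟨x, hx⟩)
  rw [← map_eq_self_of_mem_map₂_mk (g := LinearMap.id) hq (fun _ _ => rfl) hl]
  exact map_mem_map₂_mk (fun x _ => (p x).2) (fun _ hx => hx) hr

theorem comm_mem_map₂_mk {V : Type*} [AddCommGroup V] [Module K V] {P Q : Submodule K V}
    {z : V ⊗[K] V} (hz : z ∈ Submodule.map₂ (TensorProduct.mk K V V) P Q) :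
    TensorProduct.comm K V V z ∈ Submodule.map₂ (TensorProduct.mk K V V) Q P := by
  suffices Submodule.map₂ (TensorProduct.mk K V V) P Q ≤
      (Submodule.map₂ (TensorProduct.mk K V V) Q P).comap
        (TensorProduct.comm K V V).toLinearMap from this hz
  exact Submodule.map₂_le.mpr fun x hx y hy => Submodule.apply_mem_map₂ _ hy hx

theorem isYDSubmodule_iff_isAdjointStableSubcoalgebra {R : H ⊗[K] H}
    (hR : IsQuasiTriangular K H R) (D : Submodule K H) :
    IsYDSubmodule K H D ↔ IsAdjointStableSubcoalgebra K H R D := by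
  obtain ⟨s, rfl⟩ := TensorProduct.exists_finset R
  refine and_congr_right fun had => forall₂_congr fun a _ => ⟨fun ha => ?_, fun ha => ?_⟩
  · obtain ⟨t, ht⟩ := TensorProduct.exists_finset (comul a : H ⊗[K] H)
    apply mem_map₂_mk_self
    · have e : deltaR K H (∑ i ∈ s, i.1 ⊗ₜ i.2) a = ∑ i ∈ s, TensorProduct.comm K H H
          (map (mulLeft K i.1) (adMap K H ∘ₗ TensorProduct.mk K H H i.2) (comul a)) := by
        rw [deltaR_eq_sum_adAct hR a ht, ht, Finset.sum_comm]
        simp [adAct]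
      rw [e]
      exact sum_mem fun i _ => comm_mem_map₂_mk (map_mem_map₂_mk (fun _ _ => Submodule.mem_top) (had i.2) ha)
    · have e : deltaR K H (∑ i ∈ s, i.1 ⊗ₜ i.2) a = ∑ i ∈ s,
          map (mulRight K (antipode K i.2)) (adMap K H ∘ₗ TensorProduct.mk K H H i.1)
            (comul a) := by
        rw [deltaR_sum_tmul s t a ht, ht, Finset.sum_comm]
        simp [adAct]
      rw [e]
      exact sum_mem fun i _ => map_mem_map₂_mk (fun _ _ => Submodule.mem_top) (had i.1) ha
  · rw [comul_eq_sum_deltaR hR a]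
    exact sum_mem fun i _ => map_mem_map₂_mk (fun _ _ => Submodule.mem_top) (had i.1) ha

end Quasitriangular

/-- For a quasi-triangular Hopf algebra `(H,R)`, a subspace `D ⊆ H` is a
minimal nonzero Yetter–Drinfeld submodule of `H` if and only if it is a minimal nonzero
`H`-adjoint-stable subcoalgebra of the transmuted braided group `H_R`. -/
theorem minimal_yd_submodule_iff_minimal_adjoint_stable_subcoalgebra
    (R : H ⊗[K] H) (hR : IsQuasiTriangular K H R) (D : Submodule K H) :
    IsMinimalYDSubmodule K H D ↔ IsMinimalAdjointStableSubcoalgebra K H R D := by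
  simp only [IsMinimalYDSubmodule, IsMinimalAdjointStableSubcoalgebra,
    isYDSubmodule_iff_isAdjointStableSubcoalgebra hR]
end

section
/- Let (H,R) be a finite-dimensional semisimple and cosemisimple quasi-triangular Hopf algebra over a field k. Then the transmuted braided group H_R is a cosemisimple k-coalgebra. -/
open TensorProduct LinearMap

variable (K : Type) [Field K] (H : Type) [Ring H] [HopfAlgebra K H]

/-- A subcoalgebra of `(H, Δ)`. -/
def IsSubcoalgebra (D : Submodule K H) : Prop :=
  ∀ a ∈ D, Coalgebra.comul (R := K) a ∈ Submodule.map₂ (TensorProduct.mk K H H) D D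

/-- A simple (nonzero, minimal) subcoalgebra of `(H, Δ)`. -/
def IsSimpleSubcoalgebra (D : Submodule K H) : Prop :=
  D ≠ ⊥ ∧ IsSubcoalgebra K H D ∧
    ∀ D' : Submodule K H, D' ≤ D → IsSubcoalgebra K H D' → D' = ⊥ ∨ D' = D

/-- `H` is a cosemisimple coalgebra: the sum of its simple subcoalgebras is everything. -/
def IsCosemisimpleCoalgebra : Prop :=
  sSup {D : Submodule K H | IsSimpleSubcoalgebra K H D} = ⊤

/-- A subcoalgebra of the transmuted braided group `(H, Δ_R)`. -/
def IsSubcoalgebraR (R : H ⊗[K] H) (D : Submodule K H) : Prop :=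
  ∀ a ∈ D, deltaR K H R a ∈ Submodule.map₂ (TensorProduct.mk K H H) D D

/-- A simple (nonzero, minimal) subcoalgebra of `(H, Δ_R)`. -/
def IsSimpleSubcoalgebraR (R : H ⊗[K] H) (D : Submodule K H) : Prop :=
  D ≠ ⊥ ∧ IsSubcoalgebraR K H R D ∧
    ∀ D' : Submodule K H, D' ≤ D → IsSubcoalgebraR K H R D' → D' = ⊥ ∨ D' = D

/-- The coalgebra `(H, Δ_R)` is cosemisimple: it is the sum of its simple subcoalgebras. -/
def IsCosemisimpleR (R : H ⊗[K] H) : Prop :=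
  sSup {D : Submodule K H | IsSimpleSubcoalgebraR K H R D} = ⊤

section Coseparable

variable {k V : Type*} [Field k] [AddCommGroup V] [Module k V]

/-- `L_f(c) = Σ f(c₍₁₎) c₍₂₎` for a linear map `δ(c) = Σ c₍₁₎ ⊗ c₍₂₎`. -/
noncomputable def leftHit (δ : V →ₗ[k] V ⊗[k] V) : Module.Dual k V →ₗ[k] Module.End k V :=
  LinearMap.mk₂ k (fun f c => TensorProduct.lid k V (LinearMap.rTensor V f (δ c)))
    (by intros; simp [LinearMap.rTensor_add]) (by intros; simp [LinearMap.rTensor_smul])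
    (by intros; simp) (by intros; simp)

/-- `R_f(c) = Σ c₍₁₎ f(c₍₂₎)` for a linear map `δ(c) = Σ c₍₁₎ ⊗ c₍₂₎`. -/
noncomputable def rightHit (δ : V →ₗ[k] V ⊗[k] V) : Module.Dual k V →ₗ[k] Module.End k V :=
  LinearMap.mk₂ k (fun f c => TensorProduct.rid k V (LinearMap.lTensor V f (δ c)))
    (by intros; simp [LinearMap.lTensor_add]) (by intros; simp [LinearMap.lTensor_smul])
    (by intros; simp) (by intros; simp)

variable (δ : V →ₗ[k] V ⊗[k] V)

lemma leftHit_apply (f : Module.Dual k V) (c : V) :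
    leftHit δ f c = TensorProduct.lid k V (LinearMap.rTensor V f (δ c)) := rfl

lemma rightHit_apply (f : Module.Dual k V) (c : V) :
    rightHit δ f c = TensorProduct.rid k V (LinearMap.lTensor V f (δ c)) := rfl

lemma dual_leftHit (f g : Module.Dual k V) (c : V) :
    g (leftHit δ f c) = f (rightHit δ g c) := by
  rw [leftHit_apply, rightHit_apply]
  induction δ c with
  | zero => simp
  | tmul a b => simp [mul_comm]
  | add x y hx hy => simp [hx, hy]

/-- A subspace stable under all left and right hit operators. -/
def IsHitStable (D : Submodule k V) : Prop :=
  ∀ a ∈ D, ∀ f : Module.Dual k V, leftHit δ f a ∈ D ∧ rightHit δ f a ∈ D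

lemma sum_basis_tmul_lid_rTensor {ι : Type*} [Fintype ι] (b : Module.Basis ι k V)
    (t : V ⊗[k] V) :
    ∑ i, b i ⊗ₜ[k] TensorProduct.lid k V (LinearMap.rTensor V (b.coord i) t) = t := by
  induction t with
  | zero => simp
  | tmul x y =>
    simp only [rTensor_tmul, lid_tmul, ← TensorProduct.smul_tmul, ← TensorProduct.sum_tmul]
    simp [b.sum_repr]
  | add x y hx hy => simp only [map_add, tmul_add, Finset.sum_add_distrib, hx, hy]

lemma sum_rid_lTensor_tmul_basis {ι : Type*} [Fintype ι] (b : Module.Basis ι k V)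
    (t : V ⊗[k] V) :
    ∑ i, TensorProduct.rid k V (LinearMap.lTensor V (b.coord i) t) ⊗ₜ[k] b i = t := by
  induction t with
  | zero => simp
  | tmul x y =>
    simp only [lTensor_tmul, rid_tmul, TensorProduct.smul_tmul, ← TensorProduct.tmul_sum]
    simp [b.sum_repr]
  | add x y hx hy => simp only [map_add, add_tmul, Finset.sum_add_distrib, hx, hy]

lemma lid_rTensor_mem {D : Submodule k V} {t : V ⊗[k] V}
    (ht : t ∈ Submodule.map₂ (TensorProduct.mk k V V) D D) (f : Module.Dual k V) :
    TensorProduct.lid k V (LinearMap.rTensor V f t) ∈ D := by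
  have : Submodule.map₂ (TensorProduct.mk k V V) D D ≤
      D.comap ((TensorProduct.lid k V).toLinearMap ∘ₗ LinearMap.rTensor V f) :=
    Submodule.map₂_le.2 fun x _ y hy => by simpa using D.smul_mem _ hy
  exact this ht

lemma rid_lTensor_mem {D : Submodule k V} {t : V ⊗[k] V}
    (ht : t ∈ Submodule.map₂ (TensorProduct.mk k V V) D D) (f : Module.Dual k V) :
    TensorProduct.rid k V (LinearMap.lTensor V f t) ∈ D := by
  have : Submodule.map₂ (TensorProduct.mk k V V) D D ≤
      D.comap ((TensorProduct.rid k V).toLinearMap ∘ₗ LinearMap.lTensor V f) :=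
    Submodule.map₂_le.2 fun x hx y _ => by simpa using D.smul_mem _ hx
  exact this ht

lemma exists_projection (D : Submodule k V) :
    ∃ π : V →ₗ[k] V, (∀ x, π x ∈ D) ∧ ∀ x ∈ D, π x = x := by
  obtain ⟨g, hg⟩ := D.subtype.exists_leftInverse_of_injective (Submodule.ker_subtype D)
  exact ⟨D.subtype ∘ₗ g, fun x => (g x).2,
    fun x hx => congrArg Subtype.val (LinearMap.congr_fun hg ⟨x, hx⟩)⟩

lemma mem_map₂_of_slices_mem [FiniteDimensional k V] {D : Submodule k V} {t : V ⊗[k] V}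
    (hl : ∀ f : Module.Dual k V, TensorProduct.lid k V (LinearMap.rTensor V f t) ∈ D)
    (hr : ∀ f : Module.Dual k V, TensorProduct.rid k V (LinearMap.lTensor V f t) ∈ D) :
    t ∈ Submodule.map₂ (TensorProduct.mk k V V) D D := by
  obtain ⟨π, hπ, hπ'⟩ := exists_projection D
  let b := Module.finBasis k V
  have h1 : LinearMap.lTensor V π t = t := by
    refine (congrArg _ (sum_basis_tmul_lid_rTensor b t)).symm.trans ?_
    rw [map_sum]
    simp only [lTensor_tmul, hπ' _ (hl _)]
    exact sum_basis_tmul_lid_rTensor b t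
  have h2 : LinearMap.rTensor V π t = t := by
    refine (congrArg _ (sum_rid_lTensor_tmul_basis b t)).symm.trans ?_
    rw [map_sum]
    simp only [rTensor_tmul, hπ' _ (hr _)]
    exact sum_rid_lTensor_tmul_basis b t
  have h3 : TensorProduct.map π π t = t := by
    rw [← LinearMap.rTensor_comp_lTensor, LinearMap.comp_apply, h1, h2]
  rw [← h3]
  generalize t = s
  induction s with
  | zero => simp
  | tmul x y => exact Submodule.apply_mem_map₂ _ (hπ x) (hπ y)
  | add x y hx hy => rw [map_add]; exact add_mem hx hy

lemma isHitStable_iff [FiniteDimensional k V] (D : Submodule k V) :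
    IsHitStable δ D ↔ ∀ a ∈ D, δ a ∈ Submodule.map₂ (TensorProduct.mk k V V) D D :=
  ⟨fun h a ha => mem_map₂_of_slices_mem (fun f => (h a ha f).1) (fun f => (h a ha f).2),
    fun h a ha f => ⟨lid_rTensor_mem (h a ha) f, rid_lTensor_mem (h a ha) f⟩⟩

/-- The algebra of operators generated by the left and right hit operators. -/
noncomputable def hitAlgebra : Subalgebra k (Module.End k V) :=
  Algebra.adjoin k (Set.range (leftHit δ) ∪ Set.range (rightHit δ))

lemma leftHit_mem_hitAlgebra (f : Module.Dual k V) : leftHit δ f ∈ hitAlgebra δ :=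
  Algebra.subset_adjoin (Or.inl ⟨f, rfl⟩)

lemma rightHit_mem_hitAlgebra (f : Module.Dual k V) : rightHit δ f ∈ hitAlgebra δ :=
  Algebra.subset_adjoin (Or.inr ⟨f, rfl⟩)

variable {δ} in
/-- A hit-stable subspace as a submodule over the hit algebra. -/
def IsHitStable.toSubmodule {D : Submodule k V} (hD : IsHitStable δ D) :
    Submodule (hitAlgebra δ) V where
  carrier := D
  add_mem' := D.add_mem
  zero_mem' := D.zero_mem
  smul_mem' := by
    rintro ⟨c, hc⟩ x hx
    have h : ∀ y ∈ D, c y ∈ D := by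
      induction hc using Algebra.adjoin_induction with
      | mem c hc =>
        rcases hc with ⟨f, rfl⟩ | ⟨f, rfl⟩
        exacts [fun y hy => (hD y hy f).1, fun y hy => (hD y hy f).2]
      | algebraMap r => exact fun y hy => D.smul_mem r hy
      | add a b _ _ ha hb => exact fun y hy => D.add_mem (ha y hy) (hb y hy)
      | mul a b _ _ ha hb => exact fun y hy => ha _ (hb y hy)
    exact h x hx

lemma isHitStable_restrictScalars (N : Submodule (hitAlgebra δ) V) :
    IsHitStable δ (N.restrictScalars k) := fun _ ha f =>
  ⟨N.smul_mem ⟨_, leftHit_mem_hitAlgebra δ f⟩ ha, N.smul_mem ⟨_, rightHit_mem_hitAlgebra δ f⟩ ha⟩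

/-- The nonzero minimal hit-stable subspaces. -/
def IsSimpleHitStable (D : Submodule k V) : Prop :=
  D ≠ ⊥ ∧ IsHitStable δ D ∧ ∀ D' : Submodule k V, D' ≤ D → IsHitStable δ D' → D' = ⊥ ∨ D' = D

lemma sSup_simpleHitStable_eq_top_iff :
    sSup {D : Submodule k V | IsSimpleHitStable δ D} = ⊤ ↔
      IsSemisimpleModule (hitAlgebra δ) V := by
  constructor
  · intro h
    refine IsSemisimpleModule.of_sSup_simples_eq_top ?_
    rw [eq_top_iff]
    have key : sSup {D : Submodule k V | IsSimpleHitStable δ D} ≤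
        (sSup {m : Submodule (hitAlgebra δ) V |
          IsSimpleModule (hitAlgebra δ) m}).restrictScalars k := by
      refine sSup_le fun D hD => ?_
      have : hD.2.1.toSubmodule ≤ sSup {m : Submodule (hitAlgebra δ) V |
          IsSimpleModule (hitAlgebra δ) m} := by
        refine le_sSup ?_
        rw [Set.mem_ofPred_eq, isSimpleModule_iff_isAtom]
        refine ⟨fun h0 => hD.1 ?_, fun N hN => ?_⟩
        · refine (Submodule.eq_bot_iff _).2 fun x hx => ?_
          have : x ∈ hD.2.1.toSubmodule := hx
          rwa [h0, Submodule.mem_bot] at this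
        · rcases hD.2.2 (N.restrictScalars k) hN.le (isHitStable_restrictScalars δ N) with h | h
          · exact (Submodule.restrictScalars_eq_bot_iff _ _ _).1 h
          · refine absurd (fun x hx => ?_) hN.2
            exact (h.ge : D ≤ _) hx
      exact this
    rw [h] at key
    exact fun x _ => key trivial
  · intro h
    have hst : IsHitStable δ (sSup {D : Submodule k V | IsSimpleHitStable δ D}) := by
      intro a ha f
      constructor
      · have : sSup {D : Submodule k V | IsSimpleHitStable δ D} ≤
            (sSup {D : Submodule k V | IsSimpleHitStable δ D}).comap (leftHit δ f) :=
          sSup_le fun D hD x hx => (le_sSup hD : D ≤ _) (hD.2.1 x hx f).1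
        exact this ha
      · have : sSup {D : Submodule k V | IsSimpleHitStable δ D} ≤
            (sSup {D : Submodule k V | IsSimpleHitStable δ D}).comap (rightHit δ f) :=
          sSup_le fun D hD x hx => (le_sSup hD : D ≤ _) (hD.2.1 x hx f).2
        exact this ha
    have key : sSup {m : Submodule (hitAlgebra δ) V | IsSimpleModule (hitAlgebra δ) m} ≤
        hst.toSubmodule := by
      refine sSup_le fun m hm => ?_
      rw [Set.mem_ofPred_eq, isSimpleModule_iff_isAtom] at hm
      have : m.restrictScalars k ≤ sSup {D : Submodule k V | IsSimpleHitStable δ D} := by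
        refine le_sSup ⟨fun h0 => hm.1 ((Submodule.restrictScalars_eq_bot_iff _ _ _).1 h0),
          isHitStable_restrictScalars δ m, fun D' hle hD' => ?_⟩
        rcases hm.le_iff.1 (show hD'.toSubmodule ≤ m from hle) with h | h
        · left
          refine (Submodule.eq_bot_iff _).2 fun x hx => ?_
          have : x ∈ hD'.toSubmodule := hx
          rwa [h, Submodule.mem_bot] at this
        · right
          rw [← h]
          rfl
      exact this
    rw [IsSemisimpleModule.sSup_simples_eq_top] at key
    exact eq_top_iff.2 fun x _ => key trivial

end Coseparable

section Averaging

variable {k V W : Type*} [Field k] [AddCommGroup V] [Module k V] [AddCommGroup W] [Module k W]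

/-- The averaging operator `α ⊗ β ↦ σ(β) ∘ p ∘ σ(α)`. -/
noncomputable def average (σ : W →ₗ[k] Module.End k V) (p : Module.End k V) :
    W ⊗[k] W →ₗ[k] Module.End k V :=
  TensorProduct.lift (LinearMap.mk₂ k (fun α β => σ β * p * σ α)
    (by intros; simp [mul_add]) (by intros; simp)
    (by intros; simp [add_mul]) (by intros; simp))

variable (σ : W →ₗ[k] Module.End k V) (p : Module.End k V)

@[simp] lemma average_tmul (α β : W) : average σ p (α ⊗ₜ β) = σ β * p * σ α := rfl

lemma average_mul {X : Module.End k V} {P : W →ₗ[k] W} (hP : ∀ α, σ α * X = σ (P α))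
    (t : W ⊗[k] W) : average σ p t * X = average σ p (LinearMap.rTensor W P t) := by
  induction t with
  | zero => simp
  | tmul α β => simp [mul_assoc, hP]
  | add x y hx hy => simp [add_mul, hx, hy]

lemma mul_average {X : Module.End k V} {Q : W →ₗ[k] W} (hQ : ∀ β, X * σ β = σ (Q β))
    (t : W ⊗[k] W) : X * average σ p t = average σ p (LinearMap.lTensor W Q t) := by
  induction t with
  | zero => simp
  | tmul α β => simp [← mul_assoc, hQ]
  | add x y hx hy => simp [mul_add, hx, hy]

variable {σ p}

lemma Commute.average {X : Module.End k V} (hσ : ∀ α, Commute X (σ α)) (hp : Commute X p)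
    (t : W ⊗[k] W) : Commute X (average σ p t) := by
  induction t with
  | zero => simp
  | tmul α β => exact ((hσ β).mul_right hp).mul_right (hσ α)
  | add x y hx hy => rw [map_add]; exact hx.add_right hy

lemma average_apply_mem {D : Submodule k V} (hσ : ∀ α, ∀ x ∈ D, σ α x ∈ D)
    (hp : ∀ x, p x ∈ D) (t : W ⊗[k] W) (x : V) : average σ p t x ∈ D := by
  induction t with
  | zero => simp
  | tmul α β => exact hσ β _ (hp _)
  | add s t hs ht => rw [map_add]; exact D.add_mem hs ht

lemma average_apply_of_mem {D : Submodule k V} (hσ : ∀ α, ∀ x ∈ D, σ α x ∈ D)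
    (hp : ∀ x ∈ D, p x = x) (t : W ⊗[k] W) {x : V} (hx : x ∈ D) :
    average σ p t x = average σ 1 t x := by
  induction t with
  | zero => simp
  | tmul α β => simp [hp _ (hσ α x hx)]
  | add s t hs ht => simp [hs, ht]

end Averaging

section Coseparable

variable {k V : Type*} [Field k] [AddCommGroup V] [Module k V] (δ : V →ₗ[k] V ⊗[k] V)

lemma leftHit_mul_leftHit
    (hassoc : ∀ c, TensorProduct.assoc k V V V (LinearMap.rTensor V δ (δ c)) =
      LinearMap.lTensor V δ (δ c)) (f g : Module.Dual k V) :
    leftHit δ f * leftHit δ g = leftHit δ (f ∘ₗ leftHit δ g) := by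
  ext c
  let Θ : V ⊗[k] (V ⊗[k] V) →ₗ[k] V := (TensorProduct.lid k V).toLinearMap ∘ₗ
    TensorProduct.map g ((TensorProduct.lid k V).toLinearMap ∘ₗ LinearMap.rTensor V f)
  have h1 : ∀ t, Θ (LinearMap.lTensor V δ t) =
      leftHit δ f (TensorProduct.lid k V (LinearMap.rTensor V g t)) := by
    intro t
    induction t with
    | zero => simp
    | tmul x y => simp [Θ, leftHit_apply]
    | add x y hx hy => simp only [map_add, hx, hy]
  have h2 : ∀ t, Θ (TensorProduct.assoc k V V V (LinearMap.rTensor V δ t)) =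
      TensorProduct.lid k V (LinearMap.rTensor V (f ∘ₗ leftHit δ g) t) := by
    intro t
    induction t with
    | zero => simp
    | tmul x y =>
      simp only [rTensor_tmul, lid_tmul, LinearMap.comp_apply, leftHit_apply]
      induction δ x with
      | zero => simp
      | tmul a b =>
        simp only [Θ, assoc_tmul, LinearMap.comp_apply, LinearEquiv.coe_coe, map_tmul, rTensor_tmul,
          lid_tmul, map_smul, smul_eq_mul, mul_smul]
      | add a b ha hb => simp only [map_add, add_tmul, ha, hb, add_smul]
    | add x y hx hy => simp only [map_add, hx, hy]
  exact (h1 _).symm.trans ((congrArg Θ (hassoc c)).symm.trans (h2 _))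

lemma rightHit_mul_rightHit
    (hassoc : ∀ c, TensorProduct.assoc k V V V (LinearMap.rTensor V δ (δ c)) =
      LinearMap.lTensor V δ (δ c)) (f g : Module.Dual k V) :
    rightHit δ f * rightHit δ g = rightHit δ (g ∘ₗ leftHit δ f) := by
  ext c
  let Θ : V ⊗[k] (V ⊗[k] V) →ₗ[k] V := (TensorProduct.rid k V).toLinearMap ∘ₗ
    LinearMap.lTensor V ((TensorProduct.lid k k).toLinearMap ∘ₗ TensorProduct.map f g)
  have h1 : ∀ t, Θ (LinearMap.lTensor V δ t) =
      TensorProduct.rid k V (LinearMap.lTensor V (g ∘ₗ leftHit δ f) t) := by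
    intro t
    induction t with
    | zero => simp
    | tmul x y =>
      simp only [lTensor_tmul, rid_tmul, LinearMap.comp_apply, leftHit_apply]
      induction δ y with
      | zero => simp
      | tmul a b => simp [Θ]
      | add a b ha hb => simp only [map_add, tmul_add, ha, hb, add_smul]
    | add x y hx hy => simp only [map_add, hx, hy]
  have h2 : ∀ t, Θ (TensorProduct.assoc k V V V (LinearMap.rTensor V δ t)) =
      rightHit δ f (TensorProduct.rid k V (LinearMap.lTensor V g t)) := by
    intro t
    induction t with
    | zero => simp
    | tmul x y =>
      simp only [rTensor_tmul, lTensor_tmul, rid_tmul, map_smul, rightHit_apply]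
      induction δ x with
      | zero => simp
      | tmul a b => simpa [Θ, mul_smul] using smul_comm _ _ _
      | add a b ha hb => simp only [map_add, add_tmul, ha, hb, smul_add]
    | add x y hx hy => simp only [map_add, hx, hy]
  exact (h2 _).symm.trans ((congrArg Θ (hassoc c)).trans (h1 _))

lemma leftHit_commute_rightHit
    (hassoc : ∀ c, TensorProduct.assoc k V V V (LinearMap.rTensor V δ (δ c)) =
      LinearMap.lTensor V δ (δ c)) (f g : Module.Dual k V) :
    Commute (leftHit δ f) (rightHit δ g) := by
  ext c
  let Θ : V ⊗[k] (V ⊗[k] V) →ₗ[k] V := (TensorProduct.lid k V).toLinearMap ∘ₗ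
    TensorProduct.map f ((TensorProduct.rid k V).toLinearMap ∘ₗ LinearMap.lTensor V g)
  have h1 : ∀ t, Θ (LinearMap.lTensor V δ t) =
      rightHit δ g (TensorProduct.lid k V (LinearMap.rTensor V f t)) := by
    intro t
    induction t with
    | zero => simp
    | tmul x y => simp [Θ, rightHit_apply]
    | add x y hx hy => simp only [map_add, hx, hy]
  have h2 : ∀ t, Θ (TensorProduct.assoc k V V V (LinearMap.rTensor V δ t)) =
      leftHit δ f (TensorProduct.rid k V (LinearMap.lTensor V g t)) := by
    intro t
    induction t with
    | zero => simp
    | tmul x y =>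
      simp only [rTensor_tmul, lTensor_tmul, rid_tmul, map_smul, leftHit_apply]
      induction δ x with
      | zero => simp
      | tmul a b => simp [Θ]
      | add a b ha hb => simp only [map_add, add_tmul, ha, hb, smul_add]
    | add x y hx hy => simp only [map_add, hx, hy]
  exact (h2 _).symm.trans ((congrArg Θ (hassoc c)).trans (h1 _))

/-- A finite-dimensional coseparable coalgebra is the sum of its simple subcoalgebras. -/
theorem sSup_simpleHitStable_eq_top_of_coseparable [FiniteDimensional k V]
    (ε : Module.Dual k V) (hl : leftHit δ ε = 1) (hr : rightHit δ ε = 1)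
    (hassoc : ∀ c, TensorProduct.assoc k V V V (LinearMap.rTensor V δ (δ c)) =
      LinearMap.lTensor V δ (δ c))
    (γ : V ⊗[k] V →ₗ[k] k) (hγε : ∀ c, γ (δ c) = ε c)
    (hγ : ∀ t : V ⊗[k] V,
      TensorProduct.rid k V (LinearMap.lTensor V γ
        (TensorProduct.assoc k V V V (LinearMap.rTensor V δ t))) =
      TensorProduct.lid k V (LinearMap.rTensor V γ
        ((TensorProduct.assoc k V V V).symm (LinearMap.lTensor V δ t)))) :
    sSup {D : Submodule k V | IsSimpleHitStable δ D} = ⊤ := by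
  rw [sSup_simpleHitStable_eq_top_iff]
  obtain ⟨e, he⟩ := (TensorProduct.dualDistribEquiv k V V).surjective γ
  replace he : TensorProduct.dualDistrib k V V e = γ := he
  let P (f : Module.Dual k V) : Module.Dual k V →ₗ[k] Module.Dual k V :=
    Module.Dual.transpose (leftHit δ f)
  let Q (f : Module.Dual k V) : Module.Dual k V →ₗ[k] Module.Dual k V :=
    Module.Dual.transpose (rightHit δ f)
  have hPapp (f α c) : P f α c = α (leftHit δ f c) := rfl
  have hQapp (f β c) : Q f β c = β (rightHit δ f c) := rfl
  have hbal (f c d) : γ (leftHit δ f c ⊗ₜ d) = γ (c ⊗ₜ rightHit δ f d) := by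
    have h := congrArg f (hγ (c ⊗ₜ d))
    have h1 : f (TensorProduct.rid k V (LinearMap.lTensor V γ
        (TensorProduct.assoc k V V V (LinearMap.rTensor V δ (c ⊗ₜ d))))) =
        γ (leftHit δ f c ⊗ₜ d) := by
      simp only [rTensor_tmul, leftHit_apply]
      induction δ c with
      | zero => simp
      | tmul a b => simp [mul_comm, ← TensorProduct.smul_tmul']
      | add a b ha hb => simp only [map_add, add_tmul, ha, hb]
    have h2 : f (TensorProduct.lid k V (LinearMap.rTensor V γ
        ((TensorProduct.assoc k V V V).symm (LinearMap.lTensor V δ (c ⊗ₜ d))))) =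
        γ (c ⊗ₜ rightHit δ f d) := by
      simp only [lTensor_tmul, rightHit_apply]
      induction δ d with
      | zero => simp
      | tmul a b => simp [mul_comm]
      | add a b ha hb => simp only [map_add, tmul_add, ha, hb]
    rw [← h1, h, h2]
  have hPQ (f) : LinearMap.rTensor _ (P f) e = LinearMap.lTensor _ (Q f) e := by
    apply (TensorProduct.dualDistribEquiv k V V).injective
    change TensorProduct.dualDistrib k V V _ = TensorProduct.dualDistrib k V V _
    ext c d
    have h1 (t) : TensorProduct.dualDistrib k V V (LinearMap.rTensor _ (P f) t) (c ⊗ₜ d) =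
        TensorProduct.dualDistrib k V V t (leftHit δ f c ⊗ₜ d) := by
      induction t with
      | zero => simp
      | tmul a b => simp [hPapp]
      | add a b ha hb => simp only [map_add, ha, hb, LinearMap.add_apply]
    have h2 (t) : TensorProduct.dualDistrib k V V (LinearMap.lTensor _ (Q f) t) (c ⊗ₜ d) =
        TensorProduct.dualDistrib k V V t (c ⊗ₜ rightHit δ f d) := by
      induction t with
      | zero => simp
      | tmul a b => simp [hQapp]
      | add a b ha hb => simp only [map_add, ha, hb, LinearMap.add_apply]
    change TensorProduct.dualDistrib k V V _ (c ⊗ₜ d) = TensorProduct.dualDistrib k V V _ (c ⊗ₜ d)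
    rw [h1, h2, he, hbal]
  have hPQ' (f) : LinearMap.rTensor _ (Q f) (TensorProduct.comm k _ _ e) =
      LinearMap.lTensor _ (P f) (TensorProduct.comm k _ _ e) := by
    have h1 (A : Module.Dual k V →ₗ[k] Module.Dual k V)
        (t : Module.Dual k V ⊗[k] Module.Dual k V) :
        LinearMap.rTensor _ A (TensorProduct.comm k _ _ t) =
          TensorProduct.comm k _ _ (LinearMap.lTensor _ A t) := by
      induction t with
      | zero => simp
      | tmul a b => simp
      | add a b ha hb => simp only [map_add, ha, hb]
    have h2 (A : Module.Dual k V →ₗ[k] Module.Dual k V)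
        (t : Module.Dual k V ⊗[k] Module.Dual k V) :
        LinearMap.lTensor _ A (TensorProduct.comm k _ _ t) =
          TensorProduct.comm k _ _ (LinearMap.rTensor _ A t) := by
      induction t with
      | zero => simp
      | tmul a b => simp
      | add a b ha hb => simp only [map_add, ha, hb]
    rw [h1, h2, hPQ]
  have hLP (f α) : leftHit δ α * leftHit δ f = leftHit δ (P f α) :=
    leftHit_mul_leftHit δ hassoc _ _
  have hQ (f β) : Q f β = f ∘ₗ leftHit δ β := by
    ext c
    exact (dual_leftHit δ β f c).symm
  have hLQ (f β) : leftHit δ f * leftHit δ β = leftHit δ (Q f β) := by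
    rw [hQ, leftHit_mul_leftHit δ hassoc]
  have hRP (f α) : rightHit δ f * rightHit δ α = rightHit δ (P f α) :=
    rightHit_mul_rightHit δ hassoc _ _
  have hRQ (f β) : rightHit δ β * rightHit δ f = rightHit δ (Q f β) := by
    rw [hQ, rightHit_mul_rightHit δ hassoc]
  let conv : Module.Dual k V ⊗[k] Module.Dual k V →ₗ[k] Module.Dual k V :=
    TensorProduct.lift (LinearMap.mk₂ k (fun α β => P α β) (by intros; ext; simp [P])
      (by intros; ext; simp [P]) (by intros; ext; simp [P]) (by intros; ext; simp [P]))
  have hconv (α β) : conv (α ⊗ₜ β) = P α β := rfl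
  have hsum : ∀ t c, TensorProduct.dualDistrib k V V t (δ c) = conv t c := by
    intro t c
    induction t with
    | zero => simp
    | tmul a b =>
      simp only [hconv, P, Module.Dual.transpose_apply, LinearMap.comp_apply,
        leftHit_apply]
      induction δ c with
      | zero => simp
      | tmul x y => simp
      | add x y hx hy => simp only [map_add, hx, hy]
    | add a b ha hb => simp only [map_add, LinearMap.add_apply, ha, hb]
  have hε : conv e = ε := by
    ext c
    rw [← hsum, he, hγε]
  have hL1 : average (leftHit δ) 1 e = 1 := by
    refine Eq.trans ?_ hl
    rw [← hε]
    generalize e = t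
    induction t with
    | zero => simp
    | tmul a b =>
      simp only [average_tmul, mul_one, hconv, hLP]
    | add a b ha hb => simp only [map_add, ha, hb]
  have hR1 : average (rightHit δ) 1 (TensorProduct.comm k _ _ e) = 1 := by
    refine Eq.trans ?_ hr
    rw [← hε]
    generalize e = t
    induction t with
    | zero => simp
    | tmul a b =>
      simp only [TensorProduct.comm_tmul, average_tmul, mul_one, hconv, hRP]
    | add a b ha hb => simp only [map_add, ha, hb]
  refine { exists_isCompl := fun N => ?_ }
  have hN := isHitStable_restrictScalars δ N
  obtain ⟨π, hπ, hπ'⟩ := exists_projection (N.restrictScalars k)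
  let p := average (rightHit δ) (average (leftHit δ) π e) (TensorProduct.comm k _ _ e)
  have hpL (f) : Commute (leftHit δ f) p := by
    refine Commute.average (fun α => leftHit_commute_rightHit δ hassoc f α) ?_ _
    exact (mul_average _ _ (hLQ f) e).trans (((average_mul _ _ (hLP f) e).trans
      (congrArg _ (hPQ f))).symm)
  have hpR (f) : Commute (rightHit δ f) p :=
    (mul_average _ _ (hRP f) _).trans (((average_mul _ _ (hRQ f) _).trans
      (congrArg _ (hPQ' f))).symm)
  have hmem (x) : p x ∈ N.restrictScalars k :=
    average_apply_mem (fun f y hy => (hN y hy f).2)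
      (average_apply_mem (fun f y hy => (hN y hy f).1) hπ e) _ x
  have hfix (x) (hx : x ∈ N.restrictScalars k) : p x = x := by
    have h1 : ∀ y ∈ N.restrictScalars k, average (leftHit δ) π e y = y := fun y hy =>
      (average_apply_of_mem (fun f y hy => (hN y hy f).1) hπ' e hy).trans (by rw [hL1]; rfl)
    exact (average_apply_of_mem (fun f y hy => (hN y hy f).2) h1 _ hx).trans (by rw [hR1]; rfl)
  have hcomm (b : Module.End k V) (hb : b ∈ hitAlgebra δ) : Commute b p := by
    induction hb using Algebra.adjoin_induction with
    | mem c hc =>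
      rcases hc with ⟨f, rfl⟩ | ⟨f, rfl⟩
      exacts [hpL f, hpR f]
    | algebraMap r => exact Algebra.commute_algebraMap_left r p
    | add a b _ _ ha hb => exact ha.add_left hb
    | mul a b _ _ ha hb => exact ha.mul_left hb
  let q : V →ₗ[hitAlgebra δ] N :=
    { toFun := fun x => ⟨p x, hmem x⟩
      map_add' := fun x y => Subtype.ext (p.map_add x y)
      map_smul' := fun b x => Subtype.ext (LinearMap.congr_fun (hcomm b b.2).eq x).symm }
  exact ⟨LinearMap.ker q, LinearMap.isCompl_of_proj fun x => Subtype.ext (hfix x x.2)⟩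

end Coseparable

section ProductMap

variable {k M N E F : Type*} [Field k] [AddCommGroup M] [Module k M] [AddCommGroup N] [Module k N]
  [Ring E] [Algebra k E] [Ring F] [Algebra k F]

/-- The linear map `x ⊗ y ↦ A x * B y`. -/
noncomputable def tmulMap (A : M →ₗ[k] E) (B : N →ₗ[k] E) : M ⊗[k] N →ₗ[k] E :=
  LinearMap.mul' k E ∘ₗ TensorProduct.map A B

@[simp] lemma tmulMap_tmul (A : M →ₗ[k] E) (B : N →ₗ[k] E) (x : M) (y : N) :
    tmulMap A B (x ⊗ₜ y) = A x * B y := rfl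

lemma algHom_comp_tmulMap (f : E →ₐ[k] F) (A : M →ₗ[k] E) (B : N →ₗ[k] E) :
    f.toLinearMap ∘ₗ tmulMap A B = tmulMap (f.toLinearMap ∘ₗ A) (f.toLinearMap ∘ₗ B) := by
  ext; simp

lemma tmulMap_comm {A : M →ₗ[k] E} {B : N →ₗ[k] E} (h : ∀ x y, Commute (A x) (B y))
    (t : M ⊗[k] N) : tmulMap A B t = tmulMap B A (TensorProduct.comm k M N t) := by
  induction t with
  | zero => simp
  | tmul x y => exact h x y
  | add x y hx hy => simp only [map_add, hx, hy]

lemma commute_tmulMap {A : M →ₗ[k] E} {B : N →ₗ[k] E} {X : E} (hA : ∀ x, Commute X (A x))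
    (hB : ∀ y, Commute X (B y)) (t : M ⊗[k] N) : Commute X (tmulMap A B t) := by
  induction t with
  | zero => simp
  | tmul x y => exact (hA x).mul_right (hB y)
  | add x y hx hy => rw [map_add]; exact hx.add_right hy

variable {U V : Type*} [AddCommGroup U] [Module k U] [AddCommGroup V] [Module k V]

lemma comp_tmulMap {X : U →ₗ[k] V} {A : M →ₗ[k] Module.End k U} {B : N →ₗ[k] Module.End k U}
    {A' : M →ₗ[k] Module.End k V} {B' : N →ₗ[k] Module.End k V}
    (hA : ∀ x, X ∘ₗ A x = A' x ∘ₗ X) (hB : ∀ y, X ∘ₗ B y = B' y ∘ₗ X) (t : M ⊗[k] N) :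
    X ∘ₗ tmulMap A B t = tmulMap A' B' t ∘ₗ X := by
  induction t with
  | zero => simp
  | tmul x y =>
    rw [tmulMap_tmul, tmulMap_tmul, Module.End.mul_eq_comp, Module.End.mul_eq_comp,
      ← LinearMap.comp_assoc, hA, LinearMap.comp_assoc, hB, LinearMap.comp_assoc]
  | add x y hx hy => simp only [map_add, LinearMap.comp_add, LinearMap.add_comp, hx, hy]

end ProductMap

section Convolution

variable {k C E F : Type*} [Field k] [AddCommGroup C] [Module k C] [Coalgebra k C]
  [Ring E] [Algebra k E] [Ring F] [Algebra k F]

/-- The convolution product `x ↦ Σ A x₍₁₎ * B x₍₂₎`. -/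
noncomputable def convolve (A B : C →ₗ[k] E) : C →ₗ[k] E :=
  tmulMap A B ∘ₗ Coalgebra.comul

lemma convolve_apply (A B : C →ₗ[k] E) (x : C) :
    convolve A B x = tmulMap A B (Coalgebra.comul x) := rfl

lemma convolve_eq_sum (A B : C →ₗ[k] E) {ι : Type*} {x : C} (r : Coalgebra.Repr k x ι) :
    convolve A B x = ∑ i ∈ r.index, A (r.left i) * B (r.right i) := by
  rw [convolve_apply, ← r.eq, map_sum]
  rfl

lemma convolve_assoc (A B D : C →ₗ[k] E) :
    convolve (convolve A B) D = convolve A (convolve B D) :=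
  congrArg WithConv.ofConv
    (mul_assoc (WithConv.toConv A) (WithConv.toConv B) (WithConv.toConv D))

variable (k C E) in
/-- The unit `x ↦ ε(x) 1` of the convolution product. -/
noncomputable def convUnit : C →ₗ[k] E := Algebra.linearMap k E ∘ₗ Coalgebra.counit

lemma convUnit_apply (x : C) :
    convUnit k C E x = algebraMap k E (Coalgebra.counit (R := k) x) := rfl

lemma commute_convUnit (X : E) (x : C) : Commute X (convUnit k C E x) :=
  (Algebra.commutes _ _).symm

lemma convUnit_convolve (A : C →ₗ[k] E) : convolve (convUnit k C E) A = A :=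
  congrArg WithConv.ofConv (one_mul (WithConv.toConv A))

lemma convolve_convUnit (A : C →ₗ[k] E) : convolve A (convUnit k C E) = A :=
  congrArg WithConv.ofConv (mul_one (WithConv.toConv A))

lemma algHom_comp_convolve (f : E →ₐ[k] F) (A B : C →ₗ[k] E) :
    f.toLinearMap ∘ₗ convolve A B = convolve (f.toLinearMap ∘ₗ A) (f.toLinearMap ∘ₗ B) := by
  rw [convolve, ← LinearMap.comp_assoc, algHom_comp_tmulMap]
  rfl

variable {U V : Type*} [AddCommGroup U] [Module k U] [AddCommGroup V] [Module k V]

lemma comp_convolve {X : U →ₗ[k] V} {A B : C →ₗ[k] Module.End k U}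
    {A' B' : C →ₗ[k] Module.End k V} (hA : ∀ x, X ∘ₗ A x = A' x ∘ₗ X)
    (hB : ∀ x, X ∘ₗ B x = B' x ∘ₗ X) (x : C) :
    X ∘ₗ convolve A B x = convolve A' B' x ∘ₗ X :=
  comp_tmulMap hA hB _

lemma comp_convUnit (X : U →ₗ[k] V) (x : C) :
    X ∘ₗ convUnit k C (Module.End k U) x = convUnit k C (Module.End k V) x ∘ₗ X := by
  ext; simp [convUnit_apply]

end Convolution

section QuasiTriangular

variable {K H} {E : Type} [Ring E] [Algebra K E]

lemma tmulMap_mul {M N : Type} [Ring M] [Algebra K M] [Ring N] [Algebra K N]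
    {A : M →ₐ[K] E} {B : N →ₐ[K] E} (h : ∀ x y, Commute (A x) (B y)) (s t : M ⊗[K] N) :
    tmulMap A.toLinearMap B.toLinearMap (s * t) =
      tmulMap A.toLinearMap B.toLinearMap s * tmulMap A.toLinearMap B.toLinearMap t := by
  have : ∀ t, tmulMap A.toLinearMap B.toLinearMap t = Algebra.TensorProduct.lift A B h t := by
    intro t
    induction t with
    | zero => simp
    | tmul x y => simp
    | add x y hx hy => simp only [map_add, hx, hy]
  simp only [this, map_mul]

lemma tmulMap_one {M N : Type} [Ring M] [Algebra K M] [Ring N] [Algebra K N]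
    (A : M →ₐ[K] E) (B : N →ₐ[K] E) : tmulMap A.toLinearMap B.toLinearMap 1 = 1 := by
  simp [Algebra.TensorProduct.one_def]

lemma isUnit_tmulMap {M N : Type} [Ring M] [Algebra K M] [Ring N] [Algebra K N]
    {A : M →ₐ[K] E} {B : N →ₐ[K] E} (h : ∀ x y, Commute (A x) (B y)) {t : M ⊗[K] N}
    (ht : IsUnit t) : IsUnit (tmulMap A.toLinearMap B.toLinearMap t) := by
  obtain ⟨u, rfl⟩ := ht
  exact ⟨⟨_, tmulMap A.toLinearMap B.toLinearMap (u⁻¹ : (M ⊗[K] N)ˣ),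
    by rw [← tmulMap_mul h, Units.mul_inv, tmulMap_one],
    by rw [← tmulMap_mul h, Units.inv_mul, tmulMap_one]⟩, rfl⟩

lemma tmulMap_tmulMap_mul {A B C : H →ₐ[K] E} (hAB : ∀ x y, Commute (A x) (B y))
    (hAC : ∀ x y, Commute (A x) (C y)) (hBC : ∀ x y, Commute (B x) (C y))
    (s t : H ⊗[K] (H ⊗[K] H)) :
    tmulMap A.toLinearMap (tmulMap B.toLinearMap C.toLinearMap) (s * t) =
      tmulMap A.toLinearMap (tmulMap B.toLinearMap C.toLinearMap) s *
        tmulMap A.toLinearMap (tmulMap B.toLinearMap C.toLinearMap) t := by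
  have h : tmulMap B.toLinearMap C.toLinearMap =
      (Algebra.TensorProduct.lift B C hBC).toLinearMap := by
    ext; simp
  rw [h]
  refine tmulMap_mul (fun x y => ?_) s t
  rw [← AlgHom.toLinearMap_apply (Algebra.TensorProduct.lift B C hBC), ← h]
  exact commute_tmulMap (hAB x) (hAC x) y

lemma tmulMap_r12 (A B C : H →ₐ[K] E) (R : H ⊗[K] H) :
    tmulMap A.toLinearMap (tmulMap B.toLinearMap C.toLinearMap) (r12 K H R) =
      tmulMap A.toLinearMap B.toLinearMap R := by
  induction R with
  | zero => simp [r12]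
  | tmul x y => simp [r12]
  | add x y hx hy => simp only [r12, map_add] at *; rw [hx, hy]

lemma tmulMap_r13 (A B C : H →ₐ[K] E) (R : H ⊗[K] H) :
    tmulMap A.toLinearMap (tmulMap B.toLinearMap C.toLinearMap) (r13 K H R) =
      tmulMap A.toLinearMap C.toLinearMap R := by
  induction R with
  | zero => simp [r13]
  | tmul x y => simp [r13]
  | add x y hx hy => simp only [r13, map_add] at *; rw [hx, hy]

lemma tmulMap_r23 (A B C : H →ₐ[K] E) (R : H ⊗[K] H) :
    tmulMap A.toLinearMap (tmulMap B.toLinearMap C.toLinearMap) (r23 K H R) =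
      tmulMap B.toLinearMap C.toLinearMap R := by
  simp [r23]

lemma tmulMap_lTensor_comul (A B C : H →ₗ[K] E) (R : H ⊗[K] H) :
    tmulMap A (tmulMap B C) (LinearMap.lTensor H Coalgebra.comul R) =
      tmulMap A (convolve B C) R := by
  induction R with
  | zero => simp
  | tmul x y => simp [convolve_apply]
  | add x y hx hy => simp only [map_add, hx, hy]

lemma tmulMap_rTensor_comul (A B C : H →ₗ[K] E) (R : H ⊗[K] H) :
    tmulMap A (tmulMap B C)
        (TensorProduct.assoc K H H H (LinearMap.rTensor H Coalgebra.comul R)) =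
      tmulMap (convolve A B) C R := by
  induction R with
  | zero => simp
  | tmul x y =>
    simp only [rTensor_tmul, tmulMap_tmul, convolve_apply]
    induction Coalgebra.comul (R := K) x with
    | zero => simp
    | tmul a b => simp [mul_assoc]
    | add a b ha hb => simp only [map_add, add_tmul, ha, hb, add_mul]
  | add x y hx hy => simp only [map_add, hx, hy]

variable {R : H ⊗[K] H}

lemma IsQuasiTriangular.tmulMap_convolve_left (hR : IsQuasiTriangular K H R) {A B C : H →ₐ[K] E}
    (hAB : ∀ x y, Commute (A x) (B y)) (hAC : ∀ x y, Commute (A x) (C y))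
    (hBC : ∀ x y, Commute (B x) (C y)) :
    tmulMap (convolve A.toLinearMap B.toLinearMap) C.toLinearMap R =
      tmulMap A.toLinearMap C.toLinearMap R * tmulMap B.toLinearMap C.toLinearMap R := by
  rw [← tmulMap_rTensor_comul, hR.comul_rTensor, tmulMap_tmulMap_mul hAB hAC hBC, tmulMap_r13,
    tmulMap_r23]

lemma IsQuasiTriangular.tmulMap_convolve_right (hR : IsQuasiTriangular K H R)
    {A B C : H →ₐ[K] E} (hAB : ∀ x y, Commute (A x) (B y)) (hAC : ∀ x y, Commute (A x) (C y))
    (hBC : ∀ x y, Commute (B x) (C y)) :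
    tmulMap A.toLinearMap (convolve B.toLinearMap C.toLinearMap) R =
      tmulMap A.toLinearMap C.toLinearMap R * tmulMap A.toLinearMap B.toLinearMap R := by
  rw [← tmulMap_lTensor_comul, hR.comul_lTensor, tmulMap_tmulMap_mul hAB hAC hBC, tmulMap_r13,
    tmulMap_r12]

lemma IsQuasiTriangular.tmulMap_mul_convolve (hR : IsQuasiTriangular K H R) {A B : H →ₐ[K] E}
    (hAB : ∀ x y, Commute (A x) (B y)) (x : H) :
    tmulMap A.toLinearMap B.toLinearMap R * convolve A.toLinearMap B.toLinearMap x =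
      convolve B.toLinearMap A.toLinearMap x * tmulMap A.toLinearMap B.toLinearMap R := by
  rw [convolve_apply, convolve_apply, ← tmulMap_mul hAB, hR.intertwine, tmulMap_mul hAB,
    tmulMap_comm (A := B.toLinearMap) (B := A.toLinearMap) fun y x => (hAB x y).symm]

variable (K H E) in
/-- The unit of the convolution product as an algebra homomorphism. -/
noncomputable def convUnitAlgHom : H →ₐ[K] E :=
  (Algebra.ofId K E).comp (Bialgebra.counitAlgHom K H)

variable (K H E) in
lemma toLinearMap_convUnitAlgHom : (convUnitAlgHom K H E).toLinearMap = convUnit K H E := rfl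

lemma IsQuasiTriangular.tmulMap_convUnit_left (hR : IsQuasiTriangular K H R) (A : H →ₐ[K] E) :
    tmulMap (convUnit K H E) A.toLinearMap R = 1 := by
  have hc : ∀ (X : E) (x : H), Commute X (convUnitAlgHom K H E x) := commute_convUnit
  have h := hR.tmulMap_convolve_left (A := convUnitAlgHom K H E) (B := convUnitAlgHom K H E)
    (C := A) (fun _ y => hc _ y) (fun x _ => (hc _ x).symm) (fun x _ => (hc _ x).symm)
  have hu := isUnit_tmulMap (fun x y => (hc (A y) x).symm) hR.isUnit
  simp only [toLinearMap_convUnitAlgHom, convUnit_convolve] at h hu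
  exact (hu.mul_eq_left.1 h.symm)

lemma IsQuasiTriangular.tmulMap_convUnit_right (hR : IsQuasiTriangular K H R) (A : H →ₐ[K] E) :
    tmulMap A.toLinearMap (convUnit K H E) R = 1 := by
  have hc : ∀ (X : E) (x : H), Commute X (convUnitAlgHom K H E x) := commute_convUnit
  have h := hR.tmulMap_convolve_right (A := A) (B := convUnitAlgHom K H E)
    (C := convUnitAlgHom K H E) (fun _ y => hc _ y) (fun _ y => hc _ y) (fun _ y => hc _ y)
  have hu := isUnit_tmulMap (fun x y => hc (A x) y) hR.isUnit
  simp only [toLinearMap_convUnitAlgHom, convUnit_convolve] at h hu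
  exact (hu.mul_eq_left.1 h.symm)

end QuasiTriangular

section AntipodeComul

variable {K H}

lemma convolve_id_antipode :
    convolve LinearMap.id (HopfAlgebra.antipode K (A := H)) = convUnit K H H :=
  congrArg WithConv.ofConv (LinearMap.id_mul_antipode (R := K) (C := H))

lemma convolve_antipode_id :
    convolve (HopfAlgebra.antipode K (A := H)) LinearMap.id = convUnit K H H :=
  congrArg WithConv.ofConv (LinearMap.antipode_mul_id (R := K) (C := H))

lemma AlgHom.comp_convUnit {E F : Type} [Ring E] [Algebra K E] [Ring F] [Algebra K F]
    (f : E →ₐ[K] F) : f.toLinearMap ∘ₗ convUnit K H E = convUnit K H F := by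
  ext; simp [convUnit_apply]

variable (K H) in
lemma comul_eq_convolve : (Coalgebra.comul : H →ₗ[K] H ⊗[K] H) =
    convolve (Algebra.TensorProduct.includeLeft : H →ₐ[K] H ⊗[K] H).toLinearMap
      (Algebra.TensorProduct.includeRight : H →ₐ[K] H ⊗[K] H).toLinearMap := by
  have : tmulMap (Algebra.TensorProduct.includeLeft : H →ₐ[K] H ⊗[K] H).toLinearMap
      (Algebra.TensorProduct.includeRight : H →ₐ[K] H ⊗[K] H).toLinearMap = LinearMap.id := by
    ext; simp
  rw [convolve, this, LinearMap.id_comp]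

lemma convolve_comp_antipode_left {E : Type} [Ring E] [Algebra K E] (f : H →ₐ[K] E) :
    convolve (f.toLinearMap ∘ₗ HopfAlgebra.antipode K) f.toLinearMap = convUnit K H E := by
  rw [← AlgHom.comp_convUnit f, ← convolve_antipode_id, algHom_comp_convolve, LinearMap.comp_id]

lemma convolve_comp_antipode_right {E : Type} [Ring E] [Algebra K E] (f : H →ₐ[K] E) :
    convolve f.toLinearMap (f.toLinearMap ∘ₗ HopfAlgebra.antipode K) = convUnit K H E := by
  rw [← AlgHom.comp_convUnit f, ← convolve_id_antipode, algHom_comp_convolve, LinearMap.comp_id]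

/-- The antipode is an anti-coalgebra map: `Δ(S y) = Σ S(y₍₂₎) ⊗ S(y₍₁₎)`. -/
lemma comul_comp_antipode :
    Coalgebra.comul ∘ₗ HopfAlgebra.antipode K (A := H) =
      convolve
        ((Algebra.TensorProduct.includeRight : H →ₐ[K] H ⊗[K] H).toLinearMap ∘ₗ
          HopfAlgebra.antipode K)
        ((Algebra.TensorProduct.includeLeft : H →ₐ[K] H ⊗[K] H).toLinearMap ∘ₗ
          HopfAlgebra.antipode K) := by
  set iL := (Algebra.TensorProduct.includeLeft : H →ₐ[K] H ⊗[K] H)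
  set iR := (Algebra.TensorProduct.includeRight : H →ₐ[K] H ⊗[K] H)
  have h1 : convolve (Coalgebra.comul : H →ₗ[K] H ⊗[K] H)
      (Coalgebra.comul ∘ₗ HopfAlgebra.antipode K) = convUnit K H (H ⊗[K] H) := by
    have := algHom_comp_convolve (Bialgebra.comulAlgHom K H) LinearMap.id
      (HopfAlgebra.antipode K (A := H))
    rw [convolve_id_antipode, AlgHom.comp_convUnit] at this
    exact this.symm
  have h2 : convolve (convolve (iR.toLinearMap ∘ₗ HopfAlgebra.antipode K)
      (iL.toLinearMap ∘ₗ HopfAlgebra.antipode K)) (Coalgebra.comul : H →ₗ[K] H ⊗[K] H) =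
      convUnit K H (H ⊗[K] H) := by
    rw [comul_eq_convolve, convolve_assoc, ← convolve_assoc _ iL.toLinearMap,
      convolve_comp_antipode_left, convUnit_convolve, convolve_comp_antipode_left]
  have h3 := congrArg (fun X => convolve X (Coalgebra.comul ∘ₗ HopfAlgebra.antipode K)) h2
  rw [convolve_assoc, h1, convolve_convUnit, convUnit_convolve] at h3
  exact h3.symm

end AntipodeComul

section Operators

variable {K H} {U V : Type} [AddCommGroup U] [Module K U] [AddCommGroup V] [Module K V]

/-- An action on `U`, extended to the left factor of `U ⊗ V`. -/
noncomputable def actLeft (V : Type) [AddCommGroup V] [Module K V]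
    (A : H →ₐ[K] Module.End K U) : H →ₐ[K] Module.End K (U ⊗[K] V) :=
  (Module.End.rTensorAlgHom K U V).comp A

/-- An action on `V`, extended to the right factor of `U ⊗ V`. -/
noncomputable def actRight (U : Type) [AddCommGroup U] [Module K U]
    (A : H →ₐ[K] Module.End K V) : H →ₐ[K] Module.End K (U ⊗[K] V) :=
  (Module.End.lTensorAlgHom K V U).comp A

lemma actLeft_apply (A : H →ₐ[K] Module.End K U) (x : H) :
    actLeft V A x = LinearMap.rTensor V (A x) := rfl

lemma actRight_apply (A : H →ₐ[K] Module.End K V) (x : H) :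
    actRight U A x = LinearMap.lTensor U (A x) := rfl

@[simp] lemma actLeft_tmul (A : H →ₐ[K] Module.End K U) (x : H) (u : U) (v : V) :
    actLeft V A x (u ⊗ₜ v) = A x u ⊗ₜ v := rfl

@[simp] lemma actRight_tmul (A : H →ₐ[K] Module.End K V) (x : H) (u : U) (v : V) :
    actRight U A x (u ⊗ₜ v) = u ⊗ₜ A x v := rfl

lemma commute_actLeft_actRight (A : H →ₐ[K] Module.End K U) (B : H →ₐ[K] Module.End K V)
    (x y : H) : Commute (actLeft V A x) (actRight U B y) := by
  refine TensorProduct.ext' fun u v => ?_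
  simp

lemma commute_actRight_actLeft (A : H →ₐ[K] Module.End K U) (B : H →ₐ[K] Module.End K V)
    (x y : H) : Commute (actRight U B x) (actLeft V A y) :=
  (commute_actLeft_actRight A B y x).symm

lemma Commute.actLeft {A B : H →ₐ[K] Module.End K U} {x y : H} (h : Commute (A x) (B y)) :
    Commute (actLeft V A x) (actLeft V B y) :=
  h.map (Module.End.rTensorAlgHom K U V)

lemma Commute.actRight {A B : H →ₐ[K] Module.End K V} {x y : H} (h : Commute (A x) (B y)) :
    Commute (actRight U A x) (actRight U B y) :=
  h.map (Module.End.lTensorAlgHom K V U)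

lemma rTensor_tmulMap (A B : H →ₐ[K] Module.End K U) (t : H ⊗[K] H) :
    LinearMap.rTensor V (tmulMap A.toLinearMap B.toLinearMap t) =
      tmulMap (actLeft V A).toLinearMap (actLeft V B).toLinearMap t :=
  LinearMap.congr_fun (algHom_comp_tmulMap (Module.End.rTensorAlgHom K U V)
    A.toLinearMap B.toLinearMap) t

lemma lTensor_tmulMap (A B : H →ₐ[K] Module.End K V) (t : H ⊗[K] H) :
    LinearMap.lTensor U (tmulMap A.toLinearMap B.toLinearMap t) =
      tmulMap (actRight U A).toLinearMap (actRight U B).toLinearMap t :=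
  LinearMap.congr_fun (algHom_comp_tmulMap (Module.End.lTensorAlgHom K V U)
    A.toLinearMap B.toLinearMap) t

lemma lTensor_convolve (A B : H →ₐ[K] Module.End K V) (x : H) :
    LinearMap.lTensor U (convolve A.toLinearMap B.toLinearMap x) =
      convolve (actRight U A).toLinearMap (actRight U B).toLinearMap x :=
  lTensor_tmulMap _ _ _

variable (K H) in
/-- Right multiplication by the antipode, `y ↦ (a ↦ a * S y)`. -/
noncomputable def mulAntipode : H →ₐ[K] Module.End K H :=
  AlgHom.ofLinearMap ((LinearMap.mul K H).flip ∘ₗ HopfAlgebra.antipode K)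
    (by ext; simp) (fun x y => by ext; simp [HopfAlgebra.antipode_mul_antidistrib, mul_assoc])

@[simp] lemma mulAntipode_apply (y a : H) :
    mulAntipode K H y a = a * HopfAlgebra.antipode K y := rfl

lemma commute_lmul_mulAntipode (x y : H) :
    Commute (Algebra.lmul K H x) (mulAntipode K H y) := by
  ext a
  simp [mul_assoc]

variable (K H) in
/-- The left adjoint action as an algebra homomorphism. -/
noncomputable def adjointAction : H →ₐ[K] Module.End K H :=
  (Algebra.TensorProduct.lift (Algebra.lmul K H) (mulAntipode K H)
    commute_lmul_mulAntipode).comp (Bialgebra.comulAlgHom K H)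

variable (K H) in
lemma toLinearMap_adjointAction : (adjointAction K H).toLinearMap =
    convolve (Algebra.lmul K H).toLinearMap (mulAntipode K H).toLinearMap := by
  have : (Algebra.TensorProduct.lift (Algebra.lmul K H) (mulAntipode K H)
      commute_lmul_mulAntipode).toLinearMap =
      tmulMap (Algebra.lmul K H).toLinearMap (mulAntipode K H).toLinearMap := by
    ext; simp
  rw [convolve, ← this]
  rfl

lemma adjointAction_apply (h a : H) : adjointAction K H h a = adAct K H h a := by
  rw [← AlgHom.toLinearMap_apply, toLinearMap_adjointAction, adAct, adMap, convolve_apply]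
  simp only [LinearMap.comp_apply, LinearMap.rTensor_tmul]
  induction Coalgebra.comul (R := K) h with
  | zero => simp
  | tmul x y => simp
  | add x y hx hy => simp only [map_add, add_tmul, LinearMap.add_apply, hx, hy]

/-- The operator `u ⊗ v ↦ Σ u * S(R²) ⊗ R¹ ·_ad v` on `H ⊗ H`. -/
noncomputable def twist (R : H ⊗[K] H) : Module.End K (H ⊗[K] H) :=
  tmulMap (actRight H (adjointAction K H)).toLinearMap (actLeft H (mulAntipode K H)).toLinearMap R

lemma twist_mul (R S : H ⊗[K] H) : twist (R * S) = twist R * twist S :=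
  tmulMap_mul (commute_actRight_actLeft _ _) R S

lemma twist_one : twist (1 : H ⊗[K] H) = 1 := tmulMap_one _ _

lemma deltaR_eq (R : H ⊗[K] H) : deltaR K H R = twist R ∘ₗ Coalgebra.comul := by
  ext h
  simp only [deltaR, LinearMap.comp_apply, twist]
  induction Coalgebra.comul (R := K) h with
  | zero => simp
  | tmul x y =>
    simp only [LinearMap.flip_apply, mk_apply]
    induction R with
    | zero => simp
    | tmul r s => simp [adjointAction_apply, adAct]
    | add r s hr hs => simp only [map_add, tmul_add, LinearMap.add_apply, hr, hs]
  | add x y hx hy => simp only [map_add, hx, hy]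

lemma comul_comp_lmul (x : H) :
    Coalgebra.comul ∘ₗ Algebra.lmul K H x =
      convolve (actLeft H (Algebra.lmul K H)).toLinearMap
        (actRight H (Algebra.lmul K H)).toLinearMap x ∘ₗ Coalgebra.comul := by
  ext a
  have (s t : H ⊗[K] H) : tmulMap (actLeft H (Algebra.lmul K H)).toLinearMap
      (actRight H (Algebra.lmul K H)).toLinearMap s t = s * t := by
    induction s with
    | zero => simp
    | add x y hx hy => simp only [map_add, LinearMap.add_apply, add_mul, hx, hy]
    | tmul x y =>
      induction t with
      | zero => simp
      | add x y hx hy => simp only [map_add, mul_add, hx, hy]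
      | tmul u v => simp
  simp [convolve_apply, this]

lemma convolve_mulAntipode_apply (y : H) (t : H ⊗[K] H) :
    convolve (actRight H (mulAntipode K H)).toLinearMap
      (actLeft H (mulAntipode K H)).toLinearMap y t =
      t * Coalgebra.comul (R := K) (HopfAlgebra.antipode K y) := by
  rw [← LinearMap.comp_apply (Coalgebra.comul (R := K)), comul_comp_antipode]
  simp only [convolve_apply]
  induction Coalgebra.comul (R := K) y with
  | zero => simp
  | add x y hx hy => simp only [map_add, LinearMap.add_apply, mul_add, hx, hy]
  | tmul x y =>
    induction t with
    | zero => simp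
    | add x y hx hy => simp only [map_add, add_mul, hx, hy]
    | tmul u v => simp

lemma comul_comp_mulAntipode (y : H) :
    Coalgebra.comul ∘ₗ mulAntipode K H y =
      convolve (actRight H (mulAntipode K H)).toLinearMap
        (actLeft H (mulAntipode K H)).toLinearMap y ∘ₗ Coalgebra.comul := by
  ext a
  simp [convolve_mulAntipode_apply]

variable (K H) in
lemma actRight_adjointAction (U : Type) [AddCommGroup U] [Module K U] :
    (actRight U (adjointAction K H)).toLinearMap =
      convolve (actRight U (Algebra.lmul K H)).toLinearMap
        (actRight U (mulAntipode K H)).toLinearMap := by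
  have := algHom_comp_convolve (Module.End.lTensorAlgHom K H U) (Algebra.lmul K H).toLinearMap
    (mulAntipode K H).toLinearMap
  rw [← toLinearMap_adjointAction] at this
  exact this

variable (K H) in
lemma actLeft_adjointAction :
    (actLeft H (adjointAction K H)).toLinearMap =
      convolve (actLeft H (Algebra.lmul K H)).toLinearMap
        (actLeft H (mulAntipode K H)).toLinearMap := by
  have := algHom_comp_convolve (Module.End.rTensorAlgHom K H H) (Algebra.lmul K H).toLinearMap
    (mulAntipode K H).toLinearMap
  rw [← toLinearMap_adjointAction] at this
  exact this

variable (K H) in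
/-- The operator `u ⊗ v ↦ Σ x₍₁₎ u S(x₍₃₎) ⊗ x₍₂₎ ·_ad v` on `H ⊗ H`. -/
noncomputable def comulAction : H →ₗ[K] Module.End K (H ⊗[K] H) :=
  convolve (actLeft H (Algebra.lmul K H)).toLinearMap
    (convolve (actRight H (adjointAction K H)).toLinearMap
      (actLeft H (mulAntipode K H)).toLinearMap)

variable (K H) in
/-- The diagonal adjoint action on `H ⊗ H`. -/
noncomputable def diagAction : H →ₗ[K] Module.End K (H ⊗[K] H) :=
  convolve (actLeft H (adjointAction K H)).toLinearMap
    (actRight H (adjointAction K H)).toLinearMap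

variable (K H) in
lemma comulAction_eq : comulAction K H =
    convolve (convolve (actLeft H (Algebra.lmul K H)).toLinearMap
        (actRight H (Algebra.lmul K H)).toLinearMap)
      (convolve (actRight H (mulAntipode K H)).toLinearMap
        (actLeft H (mulAntipode K H)).toLinearMap) := by
  rw [comulAction, actRight_adjointAction, convolve_assoc, convolve_assoc]

lemma comul_comp_adjointAction (x : H) :
    Coalgebra.comul ∘ₗ adjointAction K H x = comulAction K H x ∘ₗ Coalgebra.comul := by
  rw [comulAction_eq, ← AlgHom.toLinearMap_apply, toLinearMap_adjointAction]
  exact comp_convolve comul_comp_lmul comul_comp_mulAntipode x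

variable {R : H ⊗[K] H}

lemma IsQuasiTriangular.twist_comp_comulAction (hR : IsQuasiTriangular K H R) (x : H) :
    twist R ∘ₗ comulAction K H x = diagAction K H x ∘ₗ twist R := by
  rw [diagAction, actLeft_adjointAction, convolve_assoc]
  refine comp_convolve (fun x => ?_) (fun x => ?_) x
  · exact (commute_tmulMap (fun y => commute_actLeft_actRight _ _ x y)
      (fun y => (commute_lmul_mulAntipode x y).actLeft) R).symm
  · exact hR.tmulMap_mul_convolve (commute_actRight_actLeft _ _) x

lemma IsQuasiTriangular.deltaR_comp_adjointAction (hR : IsQuasiTriangular K H R) (x : H) :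
    deltaR K H R ∘ₗ adjointAction K H x = diagAction K H x ∘ₗ deltaR K H R := by
  rw [deltaR_eq, LinearMap.comp_assoc, comul_comp_adjointAction, ← LinearMap.comp_assoc,
    hR.twist_comp_comulAction, LinearMap.comp_assoc]

end Operators

section TransmutedCoalgebra

variable {K H} {R : H ⊗[K] H}

/-- `R` acting on `H ⊗ H ⊗ H` through the first and second legs. -/
noncomputable def twist12 (R : H ⊗[K] H) : Module.End K (H ⊗[K] (H ⊗[K] H)) :=
  tmulMap (actRight H (actLeft H (adjointAction K H))).toLinearMap
    (actLeft (H ⊗[K] H) (mulAntipode K H)).toLinearMap R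

/-- `R` acting on `H ⊗ H ⊗ H` through the first and third legs. -/
noncomputable def twist13 (R : H ⊗[K] H) : Module.End K (H ⊗[K] (H ⊗[K] H)) :=
  tmulMap (actRight H (actRight H (adjointAction K H))).toLinearMap
    (actLeft (H ⊗[K] H) (mulAntipode K H)).toLinearMap R

/-- `R` acting on `H ⊗ H ⊗ H` through the second and third legs. -/
noncomputable def twist23 (R : H ⊗[K] H) : Module.End K (H ⊗[K] (H ⊗[K] H)) :=
  tmulMap (actRight H (actRight H (adjointAction K H))).toLinearMap
    (actRight H (actLeft H (mulAntipode K H))).toLinearMap R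

lemma lTensor_twist (R : H ⊗[K] H) : LinearMap.lTensor H (twist R) = twist23 R :=
  lTensor_tmulMap _ _ _

lemma assoc_comp_rTensor_twist (R : H ⊗[K] H) :
    (TensorProduct.assoc K H H H).toLinearMap ∘ₗ LinearMap.rTensor H (twist R) =
      twist12 R ∘ₗ (TensorProduct.assoc K H H H).toLinearMap := by
  rw [twist, rTensor_tmulMap]
  refine comp_tmulMap (fun x => ?_) (fun x => ?_) R
  · exact TensorProduct.ext_threefold fun a b c => rfl
  · exact TensorProduct.ext_threefold fun a b c => rfl

lemma comp_lTensor_commute {U V W X : Type} [AddCommGroup U] [Module K U] [AddCommGroup V]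
    [Module K V] [AddCommGroup W] [Module K W] [AddCommGroup X] [Module K X]
    (f : U →ₗ[K] V) (g : W →ₗ[K] X) :
    LinearMap.lTensor V g ∘ₗ LinearMap.rTensor W f =
      LinearMap.rTensor X f ∘ₗ LinearMap.lTensor U g := by
  rw [LinearMap.lTensor_comp_rTensor, LinearMap.rTensor_comp_lTensor]

lemma IsQuasiTriangular.comul_rTensor_comp_twist (hR : IsQuasiTriangular K H R) :
    ((TensorProduct.assoc K H H H).toLinearMap ∘ₗ
        LinearMap.rTensor H (Coalgebra.comul (R := K))) ∘ₗ twist R =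
      twist13 R ∘ₗ twist23 R ∘ₗ (TensorProduct.assoc K H H H).toLinearMap ∘ₗ
        LinearMap.rTensor H (Coalgebra.comul (R := K)) := by
  have h := hR.tmulMap_convolve_right
    (A := actRight H (actRight H (adjointAction K H)))
    (B := actRight H (actLeft H (mulAntipode K H)))
    (C := actLeft (H ⊗[K] H) (mulAntipode K H))
    (fun x y => (commute_actRight_actLeft _ _ x y).actRight)
    (commute_actRight_actLeft _ _) (commute_actRight_actLeft _ _)
  rw [← LinearMap.comp_assoc _ _ (twist13 R), ← Module.End.mul_eq_comp (twist13 R),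
    twist13, twist23, ← h]
  refine comp_tmulMap (fun x => ?_) (fun y => ?_) R
  · rw [AlgHom.toLinearMap_apply, AlgHom.toLinearMap_apply, actRight_apply,
      LinearMap.comp_assoc, ← comp_lTensor_commute, ← LinearMap.comp_assoc,
      ← LinearMap.comp_assoc]
    congr 1
    exact TensorProduct.ext_threefold fun a b c => rfl
  · rw [AlgHom.toLinearMap_apply, actLeft_apply, LinearMap.comp_assoc,
      ← LinearMap.rTensor_comp, comul_comp_mulAntipode, LinearMap.rTensor_comp,
      ← LinearMap.comp_assoc, ← LinearMap.comp_assoc]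
    congr 1
    rw [convolve_apply, convolve_apply, rTensor_tmulMap]
    refine comp_tmulMap (fun x => ?_) (fun x => ?_) _
    · exact TensorProduct.ext_threefold fun a b c => rfl
    · exact TensorProduct.ext_threefold fun a b c => rfl

lemma IsQuasiTriangular.tmulMap_diag (hR : IsQuasiTriangular K H R) :
    tmulMap
      (convolve (actRight H (actLeft H (adjointAction K H))).toLinearMap
        (actRight H (actRight H (adjointAction K H))).toLinearMap)
      (actLeft (H ⊗[K] H) (mulAntipode K H)).toLinearMap R = twist12 R * twist13 R :=
  hR.tmulMap_convolve_left
    (fun x y => (commute_actLeft_actRight _ _ x y).actRight)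
    (commute_actRight_actLeft _ _) (commute_actRight_actLeft _ _)

lemma comp_twist_of_comp_adjointAction {U : Type} [AddCommGroup U] [Module K U]
    (f : H →ₗ[K] U) (A : H →ₗ[K] Module.End K U)
    (hf : ∀ x, f ∘ₗ adjointAction K H x = A x ∘ₗ f) (R : H ⊗[K] H) :
    LinearMap.lTensor H f ∘ₗ twist R =
      tmulMap ((Module.End.lTensorAlgHom K U H).toLinearMap ∘ₗ A)
        (actLeft U (mulAntipode K H)).toLinearMap R ∘ₗ LinearMap.lTensor H f := by
  refine comp_tmulMap (fun x => ?_) (fun y => ?_) R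
  · change LinearMap.lTensor H f ∘ₗ LinearMap.lTensor H (adjointAction K H x) =
      LinearMap.lTensor H (A x) ∘ₗ LinearMap.lTensor H f
    rw [← LinearMap.lTensor_comp, hf, LinearMap.lTensor_comp]
  · exact comp_lTensor_commute _ _

lemma IsQuasiTriangular.lTensor_deltaR_comp_twist (hR : IsQuasiTriangular K H R) :
    LinearMap.lTensor H (deltaR K H R) ∘ₗ twist R =
      twist12 R ∘ₗ twist13 R ∘ₗ LinearMap.lTensor H (deltaR K H R) := by
  rw [comp_twist_of_comp_adjointAction _ _ hR.deltaR_comp_adjointAction, ← LinearMap.comp_assoc,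
    ← Module.End.mul_eq_comp, ← hR.tmulMap_diag]
  congr 3
  exact LinearMap.ext fun x => lTensor_convolve _ _ x

lemma IsQuasiTriangular.lTensor_deltaR_comp_twist' (hR : IsQuasiTriangular K H R) :
    LinearMap.lTensor H (deltaR K H R) ∘ₗ twist R =
      twist12 R ∘ₗ twist13 R ∘ₗ twist23 R ∘ₗ LinearMap.lTensor H (Coalgebra.comul (R := K)) := by
  rw [hR.lTensor_deltaR_comp_twist, deltaR_eq, LinearMap.lTensor_comp, lTensor_twist]

lemma IsQuasiTriangular.assoc_rTensor_deltaR_comp_twist (hR : IsQuasiTriangular K H R) :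
    ((TensorProduct.assoc K H H H).toLinearMap ∘ₗ LinearMap.rTensor H (deltaR K H R)) ∘ₗ twist R =
      twist12 R ∘ₗ twist13 R ∘ₗ twist23 R ∘ₗ (TensorProduct.assoc K H H H).toLinearMap ∘ₗ
        LinearMap.rTensor H (Coalgebra.comul (R := K)) := by
  rw [deltaR_eq, LinearMap.rTensor_comp, ← LinearMap.comp_assoc _ (LinearMap.rTensor H (twist R)),
    assoc_comp_rTensor_twist, LinearMap.comp_assoc _ _ (twist12 R),
    LinearMap.comp_assoc _ _ (twist12 R), hR.comul_rTensor_comp_twist]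

/-- The comultiplication `Δ_R` is coassociative. -/
lemma IsQuasiTriangular.deltaR_coassoc (hR : IsQuasiTriangular K H R) (c : H) :
    TensorProduct.assoc K H H H (LinearMap.rTensor H (deltaR K H R) (deltaR K H R c)) =
      LinearMap.lTensor H (deltaR K H R) (deltaR K H R c) := by
  have h1 := LinearMap.congr_fun hR.assoc_rTensor_deltaR_comp_twist (Coalgebra.comul c)
  have h2 := LinearMap.congr_fun hR.lTensor_deltaR_comp_twist' (Coalgebra.comul c)
  simp only [LinearMap.comp_apply, LinearEquiv.coe_coe, Coalgebra.coassoc_apply] at h1 h2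
  have h3 : deltaR K H R c = twist R (Coalgebra.comul c) := by rw [deltaR_eq]; rfl
  rw [h3, h1, h2]

variable (K H) in
lemma counit_comp_lmul (x : H) :
    Coalgebra.counit ∘ₗ Algebra.lmul K H x =
      convUnit K H (Module.End K K) x ∘ₗ Coalgebra.counit := by
  ext a
  simp [convUnit_apply]

variable (K H) in
lemma counit_comp_mulAntipode (x : H) :
    Coalgebra.counit ∘ₗ mulAntipode K H x =
      convUnit K H (Module.End K K) x ∘ₗ Coalgebra.counit := by
  ext a
  simp [convUnit_apply, mul_comm]

variable (K H) in
lemma counit_comp_adjointAction (x : H) :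
    Coalgebra.counit ∘ₗ adjointAction K H x =
      convUnit K H (Module.End K K) x ∘ₗ Coalgebra.counit := by
  rw [← AlgHom.toLinearMap_apply, toLinearMap_adjointAction,
    comp_convolve (counit_comp_lmul K H) (counit_comp_mulAntipode K H), convUnit_convolve]

lemma IsQuasiTriangular.leftHit_deltaR_counit (hR : IsQuasiTriangular K H R) :
    leftHit (deltaR K H R) Coalgebra.counit = 1 := by
  have h : ((TensorProduct.lid K H).toLinearMap ∘ₗ
      LinearMap.rTensor H (Coalgebra.counit (R := K))) ∘ₗ twist R =
      tmulMap (adjointAction K H).toLinearMap (convUnit K H (Module.End K H)) R ∘ₗ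
        (TensorProduct.lid K H).toLinearMap ∘ₗ LinearMap.rTensor H (Coalgebra.counit (R := K)) := by
    refine comp_tmulMap (fun x => ?_) (fun y => ?_) R
    · exact TensorProduct.ext' fun u v => by simp
    · exact TensorProduct.ext' fun u v => by
        simp [convUnit_apply, mul_smul]
  rw [hR.tmulMap_convUnit_right] at h
  ext c
  have := LinearMap.congr_fun h (Coalgebra.comul c)
  rw [leftHit_apply, deltaR_eq]
  simpa using this

lemma IsQuasiTriangular.rightHit_deltaR_counit (hR : IsQuasiTriangular K H R) :
    rightHit (deltaR K H R) Coalgebra.counit = 1 := by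
  have h : ((TensorProduct.rid K H).toLinearMap ∘ₗ
      LinearMap.lTensor H (Coalgebra.counit (R := K))) ∘ₗ twist R =
      tmulMap (convUnit K H (Module.End K H)) (mulAntipode K H).toLinearMap R ∘ₗ
        (TensorProduct.rid K H).toLinearMap ∘ₗ LinearMap.lTensor H (Coalgebra.counit (R := K)) := by
    refine comp_tmulMap (fun x => ?_) (fun y => ?_) R
    · refine TensorProduct.ext' fun u v => ?_
      have := LinearMap.congr_fun (counit_comp_adjointAction K H x) v
      simp only [LinearMap.comp_apply] at this
      simpa [this, convUnit_apply, mul_smul] using smul_comm _ _ _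
    · exact TensorProduct.ext' fun u v => by simp
  rw [hR.tmulMap_convUnit_left] at h
  ext c
  have := LinearMap.congr_fun h (Coalgebra.comul c)
  rw [rightHit_apply, deltaR_eq]
  simpa using this

end TransmutedCoalgebra

section IntegralFunctional

variable {K H}

variable (K H) in
lemma isSimpleSubcoalgebra_iff [FiniteDimensional K H] (D : Submodule K H) :
    IsSimpleSubcoalgebra K H D ↔ IsSimpleHitStable (Coalgebra.comul (R := K)) D := by
  simp only [IsSimpleSubcoalgebra, IsSimpleHitStable, IsSubcoalgebra, isHitStable_iff]

lemma isSimpleSubcoalgebraR_iff [FiniteDimensional K H] (R : H ⊗[K] H) (D : Submodule K H) :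
    IsSimpleSubcoalgebraR K H R D ↔ IsSimpleHitStable (deltaR K H R) D := by
  simp only [IsSimpleSubcoalgebraR, IsSimpleHitStable, IsSubcoalgebraR, isHitStable_iff]

lemma leftHit_comul_one (f : Module.Dual K H) :
    leftHit (Coalgebra.comul (R := K)) f (1 : H) = f 1 • 1 := by
  simp [leftHit_apply, Algebra.TensorProduct.one_def]

lemma rightHit_comul_one (f : Module.Dual K H) :
    rightHit (Coalgebra.comul (R := K)) f (1 : H) = f 1 • 1 := by
  simp [rightHit_apply, Algebra.TensorProduct.one_def]

lemma isHitStable_span_one : IsHitStable (Coalgebra.comul (R := K)) (K ∙ (1 : H)) := by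
  intro a ha f
  obtain ⟨r, rfl⟩ := Submodule.mem_span_singleton.1 ha
  rw [map_smul, map_smul, leftHit_comul_one, rightHit_comul_one, and_self]
  exact Submodule.smul_mem _ _ (Submodule.smul_mem _ _ (Submodule.mem_span_singleton_self 1))

/-- A cosemisimple finite-dimensional Hopf algebra has a normalised two-sided integral in its
dual. -/
lemma IsCosemisimpleCoalgebra.exists_integral [FiniteDimensional K H]
    (hcoss : IsCosemisimpleCoalgebra K H) :
    ∃ f : Module.Dual K H, f 1 = 1 ∧
      (∀ h, leftHit (Coalgebra.comul (R := K)) f h = f h • (1 : H)) ∧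
      ∀ h, rightHit (Coalgebra.comul (R := K)) f h = f h • (1 : H) := by
  have hss : IsSemisimpleModule (hitAlgebra (Coalgebra.comul (R := K) (A := H))) H := by
    rw [← sSup_simpleHitStable_eq_top_iff]
    simpa only [IsCosemisimpleCoalgebra, isSimpleSubcoalgebra_iff] using hcoss
  obtain ⟨N, hN⟩ := hss.exists_isCompl (isHitStable_span_one (K := K) (H := H)).toSubmodule
  have hst := isHitStable_restrictScalars (Coalgebra.comul (R := K) (A := H)) N
  have hdec : ∀ h : H, ∃ r : K, ∃ n ∈ N, h = r • 1 + n := by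
    intro h
    have : h ∈ (isHitStable_span_one (K := K) (H := H)).toSubmodule ⊔ N := by
      rw [hN.sup_eq_top]; trivial
    obtain ⟨y, hy, n, hn, rfl⟩ := Submodule.mem_sup.1 this
    obtain ⟨r, rfl⟩ := Submodule.mem_span_singleton.1 hy
    exact ⟨r, n, hn, rfl⟩
  have hone : (1 : H) ∉ N.restrictScalars K := by
    intro h1
    have : (1 : H) ∈ (isHitStable_span_one (K := K) (H := H)).toSubmodule ⊓ N :=
      ⟨Submodule.mem_span_singleton_self 1, h1⟩
    rw [hN.inf_eq_bot, Submodule.mem_bot] at this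
    have := congrArg (Coalgebra.counit (R := K)) this
    simp at this
  obtain ⟨f, hf1, hf⟩ := Submodule.exists_dual_map_eq_bot_of_notMem hone inferInstance
  have hfN : ∀ n ∈ N, f n = 0 := fun n hn => by
    have : f n ∈ (N.restrictScalars K).map f := Submodule.mem_map_of_mem hn
    rwa [hf, Submodule.mem_bot] at this
  have hg1 : ((f 1)⁻¹ • f) 1 = 1 := by simp [hf1]
  have hgN : ∀ n ∈ N, ((f 1)⁻¹ • f) n = 0 := fun n hn => by simp [hfN n hn]
  generalize (f 1)⁻¹ • f = g at hg1 hgN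
  refine ⟨g, hg1, fun h => ?_, fun h => ?_⟩ <;> obtain ⟨r, n, hn, rfl⟩ := hdec h
  · have : leftHit (Coalgebra.comul (R := K)) g n = 0 := by
      rw [← Module.forall_dual_apply_eq_zero_iff K]
      exact fun φ => (dual_leftHit _ _ _ _).trans (hgN _ (hst n hn φ).2)
    rw [map_add, map_smul, leftHit_comul_one, this, map_add, map_smul, hgN n hn, hg1]
    simp
  · have : rightHit (Coalgebra.comul (R := K)) g n = 0 := by
      rw [← Module.forall_dual_apply_eq_zero_iff K]
      exact fun φ => (dual_leftHit _ _ _ _).symm.trans (hgN _ (hst n hn φ).1)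
    rw [map_add, map_smul, rightHit_comul_one, this, map_add, map_smul, hgN n hn, hg1]
    simp

end IntegralFunctional

section Integral

variable {K H}

lemma exists_leftIntegral {A : Type} [Ring A] [Algebra K A] [IsSemisimpleRing A]
    (χ : A →ₐ[K] K) : ∃ Λ : A, χ Λ = 1 ∧ ∀ a, a * Λ = χ a • Λ := by
  obtain ⟨J, hJ⟩ := exists_isCompl (RingHom.ker χ)
  have h1 : (1 : A) ∈ RingHom.ker χ ⊔ J := by
    rw [hJ.sup_eq_top]; trivial
  obtain ⟨i, hi, Λ, hΛ, h⟩ := Submodule.mem_sup.1 h1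
  have hχ : χ Λ = 1 := by
    have := congrArg χ h
    rwa [map_add, (RingHom.mem_ker).1 hi, zero_add, map_one] at this
  refine ⟨Λ, hχ, fun a => sub_eq_zero.1 ?_⟩
  have : a * Λ - χ a • Λ ∈ RingHom.ker χ ⊓ J := by
    refine ⟨?_, J.sub_mem (J.mul_mem_left a hΛ) ?_⟩
    · change χ _ = 0; simp [hχ]
    · rw [Algebra.smul_def]; exact J.mul_mem_left _ hΛ
  rwa [hJ.inf_eq_bot] at this

/-- A semisimple Hopf algebra has a normalised two-sided integral. -/
lemma exists_integral (hss : IsSemisimpleRing H) :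
    ∃ Λ : H, Coalgebra.counit (R := K) Λ = 1 ∧
      (∀ a, a * Λ = Coalgebra.counit (R := K) a • Λ) ∧
      ∀ a, Λ * a = Coalgebra.counit (R := K) a • Λ := by
  obtain ⟨Λ, h1, hl⟩ := exists_leftIntegral (Bialgebra.counitAlgHom K H)
  obtain ⟨Λ', h1', hr⟩ := exists_leftIntegral
    ((Bialgebra.counitAlgHom K H).fromOpposite fun _ _ => Commute.all _ _)
  replace hr : ∀ a, Λ'.unop * a = Coalgebra.counit (R := K) a • Λ'.unop := fun a =>
    congrArg MulOpposite.unop (hr (MulOpposite.op a))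
  replace h1 : Coalgebra.counit (R := K) Λ = 1 := h1
  replace h1' : Coalgebra.counit (R := K) Λ'.unop = 1 := h1'
  have : Λ = Λ'.unop := by
    have := (hl Λ'.unop).symm.trans (hr Λ)
    simpa [h1, h1'] using this
  exact ⟨Λ, h1, hl, this ▸ hr⟩

lemma tmulMap_mul_congr {M N E : Type} [AddCommGroup M] [Module K M] [AddCommGroup N] [Module K N]
    [Ring E] [Algebra K E] (A : M →ₗ[K] E) {B B' : N →ₗ[K] E} {v : E}
    (h : ∀ y, B y * v = B' y * v) (t : M ⊗[K] N) : tmulMap A B t * v = tmulMap A B' t * v := by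
  induction t with
  | zero => simp
  | tmul x y => simp [mul_assoc, h]
  | add x y hx hy => simp only [map_add, add_mul, hx, hy]

lemma mul_tmulMap_congr {M N E : Type} [AddCommGroup M] [Module K M] [AddCommGroup N] [Module K N]
    [Ring E] [Algebra K E] {A A' : M →ₗ[K] E} (B : N →ₗ[K] E) {v : E}
    (h : ∀ y, v * A y = v * A' y) (t : M ⊗[K] N) : v * tmulMap A B t = v * tmulMap A' B t := by
  induction t with
  | zero => simp
  | tmul x y => simp [← mul_assoc, h]
  | add x y hx hy => simp only [map_add, mul_add, hx, hy]

lemma one_tmul_mul_comul {Λ : H} (hΛ : ∀ a, a * Λ = Coalgebra.counit (R := K) a • Λ) (a : H) :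
    ((1 : H) ⊗ₜ[K] a) * Coalgebra.comul Λ =
      (HopfAlgebra.antipode K a ⊗ₜ[K] (1 : H)) * Coalgebra.comul Λ := by
  set iL := (Algebra.TensorProduct.includeLeft : H →ₐ[K] H ⊗[K] H)
  set iR := (Algebra.TensorProduct.includeRight : H →ₐ[K] H ⊗[K] H)
  have h : iR.toLinearMap =
      convolve (iL.toLinearMap ∘ₗ HopfAlgebra.antipode K) Coalgebra.comul := by
    rw [comul_eq_convolve, ← convolve_assoc, convolve_comp_antipode_left, convUnit_convolve]
  calc iR.toLinearMap a * Coalgebra.comul Λ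
      = convolve (iL.toLinearMap ∘ₗ HopfAlgebra.antipode K) (convUnit K H (H ⊗[K] H)) a *
          Coalgebra.comul Λ := by
        rw [h]
        refine tmulMap_mul_congr _ (fun y => ?_) _
        rw [← Bialgebra.comul_mul, hΛ, map_smul, convUnit_apply, Algebra.smul_def]
    _ = _ := by
        rw [convolve_convUnit]
        rfl

lemma comul_mul_tmul_one {Λ : H} (hΛ : ∀ a, Λ * a = Coalgebra.counit (R := K) a • Λ) (a : H) :
    Coalgebra.comul Λ * (a ⊗ₜ[K] (1 : H)) =
      Coalgebra.comul Λ * ((1 : H) ⊗ₜ[K] HopfAlgebra.antipode K a) := by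
  set iL := (Algebra.TensorProduct.includeLeft : H →ₐ[K] H ⊗[K] H)
  set iR := (Algebra.TensorProduct.includeRight : H →ₐ[K] H ⊗[K] H)
  have h : iL.toLinearMap =
      convolve Coalgebra.comul (iR.toLinearMap ∘ₗ HopfAlgebra.antipode K) := by
    rw [comul_eq_convolve, convolve_assoc, convolve_comp_antipode_right, convolve_convUnit]
  calc Coalgebra.comul Λ * iL.toLinearMap a
      = Coalgebra.comul Λ *
          convolve (convUnit K H (H ⊗[K] H)) (iR.toLinearMap ∘ₗ HopfAlgebra.antipode K) a := by
        rw [h]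
        refine mul_tmulMap_congr _ (fun y => ?_) _
        rw [← Bialgebra.comul_mul, hΛ, map_smul, convUnit_apply, Algebra.smul_def,
          Algebra.commutes]
    _ = _ := by
        rw [convUnit_convolve]
        rfl

variable {f : Module.Dual K H} {Λ : H}

lemma rid_lTensor_comul_integral
    (hf : ∀ h, rightHit (Coalgebra.comul (R := K)) f h = f h • (1 : H))
    (hΛ : ∀ a, a * Λ = Coalgebra.counit (R := K) a • Λ) (b : H) :
    TensorProduct.rid K H (LinearMap.lTensor H f (((1 : H) ⊗ₜ[K] b) * Coalgebra.comul Λ)) =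
      f Λ • HopfAlgebra.antipode K b := by
  have h (a : H) (t : H ⊗[K] H) : TensorProduct.rid K H
      (LinearMap.lTensor H f ((a ⊗ₜ[K] (1 : H)) * t)) =
      a * TensorProduct.rid K H (LinearMap.lTensor H f t) := by
    induction t with
    | zero => simp
    | tmul x y => simp
    | add x y hx hy => simp only [map_add, mul_add, hx, hy]
  rw [one_tmul_mul_comul hΛ, h, ← rightHit_apply, hf, mul_smul_comm, mul_one]

lemma lid_rTensor_comul_integral
    (hf : ∀ h, leftHit (Coalgebra.comul (R := K)) f h = f h • (1 : H))
    (hΛ : ∀ a, Λ * a = Coalgebra.counit (R := K) a • Λ) (b : H) :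
    TensorProduct.lid K H (LinearMap.rTensor H f (Coalgebra.comul Λ * (b ⊗ₜ[K] (1 : H)))) =
      f Λ • HopfAlgebra.antipode K b := by
  have h (a : H) (t : H ⊗[K] H) : TensorProduct.lid K H
      (LinearMap.rTensor H f (t * ((1 : H) ⊗ₜ[K] a))) =
      TensorProduct.lid K H (LinearMap.rTensor H f t) * a := by
    induction t with
    | zero => simp
    | tmul x y => simp
    | add x y hx hy => simp only [map_add, add_mul, hx, hy]
  rw [comul_mul_tmul_one hΛ, h, ← leftHit_apply, hf, smul_mul_assoc, one_mul]

lemma integral_apply_ne_zero [FiniteDimensional K H] (hf1 : f 1 = 1)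
    (hf : ∀ h, rightHit (Coalgebra.comul (R := K)) f h = f h • (1 : H))
    (hΛ1 : Coalgebra.counit (R := K) Λ = 1)
    (hΛ : ∀ a, a * Λ = Coalgebra.counit (R := K) a • Λ) : f Λ ≠ 0 := by
  intro h0
  let b := Module.finBasis K H
  have key (t : H ⊗[K] H) :
      f (LinearMap.mul' K H (LinearMap.rTensor H (HopfAlgebra.antipode K) t)) =
      ∑ i, b.coord i (TensorProduct.rid K H (LinearMap.lTensor H f
        (((1 : H) ⊗ₜ[K] HopfAlgebra.antipode K (b i)) * t))) := by
    induction t with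
    | zero => simp
    | add x y hx hy => simp only [map_add, mul_add, hx, hy, Finset.sum_add_distrib]
    | tmul x y =>
      have hx : HopfAlgebra.antipode K x = ∑ i, b.repr x i • HopfAlgebra.antipode K (b i) := by
        conv_lhs => rw [← b.sum_repr x]
        simp only [map_sum, map_smul]
      simp [hx, Finset.sum_mul, mul_comm]
  have := key (Coalgebra.comul Λ)
  simp only [rid_lTensor_comul_integral hf hΛ, h0, zero_smul, map_zero, Finset.sum_const_zero,
    HopfAlgebra.mul_antipode_rTensor_comul_apply, hΛ1, map_one, hf1] at this
  exact one_ne_zero this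

/-- The compatibility of the normalised integrals with the antipode. -/
lemma integral_mul_antipode
    (hfl : ∀ h, leftHit (Coalgebra.comul (R := K)) f h = f h • (1 : H))
    (hfr : ∀ h, rightHit (Coalgebra.comul (R := K)) f h = f h • (1 : H))
    (hl : ∀ a, a * Λ = Coalgebra.counit (R := K) a • Λ)
    (hr : ∀ a, Λ * a = Coalgebra.counit (R := K) a • Λ) (h0 : f Λ ≠ 0) (a b : H) :
    f (a * HopfAlgebra.antipode K b) = f (HopfAlgebra.antipode K a * b) := by
  have key (t : H ⊗[K] H) :
      f (a * TensorProduct.lid K H (LinearMap.rTensor H f (t * (b ⊗ₜ[K] (1 : H))))) =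
      f (TensorProduct.rid K H (LinearMap.lTensor H f (((1 : H) ⊗ₜ[K] a) * t)) * b) := by
    induction t with
    | zero => simp
    | tmul x y => simp [mul_comm]
    | add x y hx hy => simp only [map_add, mul_add, add_mul, hx, hy]
  have := key (Coalgebra.comul Λ)
  rw [lid_rTensor_comul_integral hfl hr, rid_lTensor_comul_integral hfr hl, mul_smul_comm,
    smul_mul_assoc, map_smul, map_smul] at this
  exact smul_right_injective K h0 this

/-- The normalised integral functional is invariant under the adjoint action. -/
lemma integral_comp_adjointAction
    (hf : ∀ a b, f (a * HopfAlgebra.antipode K b) = f (HopfAlgebra.antipode K a * b)) (x : H) :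
    f ∘ₗ adjointAction K H x = convUnit K H (Module.End K K) x ∘ₗ f := by
  ext a
  have h1 : f (HopfAlgebra.antipode K a) = f a := by
    have := hf a 1
    rwa [HopfAlgebra.antipode_one, mul_one, mul_one, eq_comm] at this
  rw [LinearMap.comp_apply, ← AlgHom.toLinearMap_apply, toLinearMap_adjointAction,
    convolve_eq_sum _ _ (Coalgebra.Repr.arbitrary K x)]
  have h2 := HopfAlgebra.sum_antipode_mul_eq_smul (Coalgebra.Repr.arbitrary K x)
  simp only [LinearMap.sum_apply, map_sum, AlgHom.toLinearMap_apply, Module.End.mul_apply,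
    mulAntipode_apply, Algebra.coe_lmul_eq_mul, LinearMap.mul_apply_apply, ← mul_assoc, hf, HopfAlgebra.antipode_mul_antidistrib]
  simp only [mul_assoc, ← map_sum, ← Finset.mul_sum, h2]
  simp [h1, convUnit_apply]

end Integral

section Coseparability

variable {K H}

variable (K H) in
/-- The linear map `u ⊗ v ↦ u * S v`. -/
noncomputable def mulAntipodeRight : H ⊗[K] H →ₗ[K] H :=
  LinearMap.mul' K H ∘ₗ LinearMap.lTensor H (HopfAlgebra.antipode K)

@[simp] lemma mulAntipodeRight_tmul (u v : H) :
    mulAntipodeRight K H (u ⊗ₜ v) = u * HopfAlgebra.antipode K v := rfl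

lemma mulAntipodeRight_mul_comul (t : H ⊗[K] H) (z : H) :
    mulAntipodeRight K H (t * Coalgebra.comul z) =
      Coalgebra.counit (R := K) z • mulAntipodeRight K H t := by
  induction t with
  | zero => simp
  | add x y hx hy => simp only [map_add, add_mul, hx, hy, smul_add]
  | tmul u v =>
    have h (s : H ⊗[K] H) : mulAntipodeRight K H ((u ⊗ₜ v) * s) =
        u * mulAntipodeRight K H s * HopfAlgebra.antipode K v := by
      induction s with
      | zero => simp
      | add x y hx hy => simp only [map_add, mul_add, add_mul, hx, hy]
      | tmul x y => simp [HopfAlgebra.antipode_mul_antidistrib, mul_assoc]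
    rw [h, mulAntipodeRight, LinearMap.comp_apply, HopfAlgebra.mul_antipode_lTensor_comul_apply,
      ← Algebra.commutes, mul_assoc, ← Algebra.smul_def]
    rfl

lemma mulAntipodeRight_comp_convolve (y : H) :
    mulAntipodeRight K H ∘ₗ convolve (actRight H (mulAntipode K H)).toLinearMap
        (actLeft H (mulAntipode K H)).toLinearMap y =
      convUnit K H (Module.End K H) y ∘ₗ mulAntipodeRight K H := by
  refine LinearMap.ext fun t => ?_
  rw [LinearMap.comp_apply, convolve_mulAntipode_apply, mulAntipodeRight_mul_comul]
  simp [convUnit_apply]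

lemma mulAntipodeRight_comp_comulAction (x : H) :
    mulAntipodeRight K H ∘ₗ comulAction K H x =
      adjointAction K H x ∘ₗ mulAntipodeRight K H := by
  have h1 (y : H) : mulAntipodeRight K H ∘ₗ (actLeft H (Algebra.lmul K H)).toLinearMap y =
      (Algebra.lmul K H).toLinearMap y ∘ₗ mulAntipodeRight K H :=
    TensorProduct.ext' fun u v => by simp [mul_assoc]
  have h2 (y : H) : mulAntipodeRight K H ∘ₗ (actRight H (Algebra.lmul K H)).toLinearMap y =
      (mulAntipode K H).toLinearMap y ∘ₗ mulAntipodeRight K H :=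
    TensorProduct.ext' fun u v => by simp [HopfAlgebra.antipode_mul_antidistrib, mul_assoc]
  rw [comulAction_eq, comp_convolve (comp_convolve h1 h2) mulAntipodeRight_comp_convolve,
    convolve_convUnit, ← toLinearMap_adjointAction, AlgHom.toLinearMap_apply]

variable {f : Module.Dual K H}

/-- An integral in the dual gives a coseparability form for the ordinary comultiplication. -/
lemma coseparable_comul (hf : ∀ h, rightHit (Coalgebra.comul (R := K)) f h = f h • (1 : H)) :
    (TensorProduct.rid K H).toLinearMap ∘ₗ LinearMap.lTensor H (f ∘ₗ mulAntipodeRight K H) ∘ₗ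
        (TensorProduct.assoc K H H H).toLinearMap ∘ₗ
          LinearMap.rTensor H (Coalgebra.comul (R := K)) =
      (TensorProduct.lid K H).toLinearMap ∘ₗ LinearMap.rTensor H (f ∘ₗ mulAntipodeRight K H) ∘ₗ
        (TensorProduct.assoc K H H H).symm.toLinearMap ∘ₗ
          LinearMap.lTensor H (Coalgebra.comul (R := K)) := by
  refine TensorProduct.ext' fun u v => ?_
  set iL := (Algebra.TensorProduct.includeLeft : H →ₐ[K] H ⊗[K] H)
  set iR := (Algebra.TensorProduct.includeRight : H →ₐ[K] H ⊗[K] H)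
  let F (t : H ⊗[K] H) : H →ₗ[K] H := (TensorProduct.rid K H).toLinearMap ∘ₗ
    LinearMap.lTensor H f ∘ₗ LinearMap.mulLeft K t ∘ₗ iR.toLinearMap ∘ₗ HopfAlgebra.antipode K
  let G : H →ₗ[K] H := Algebra.linearMap K H ∘ₗ f ∘ₗ LinearMap.mulLeft K u ∘ₗ
    HopfAlgebra.antipode K
  have hF (t : H ⊗[K] H) : TensorProduct.rid K H (LinearMap.lTensor H (f ∘ₗ mulAntipodeRight K H)
      (TensorProduct.assoc K H H H (t ⊗ₜ v))) = F t v := by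
    induction t with
    | zero => simp [F]
    | tmul x y => simp [F, iR]
    | add x y hx hy => simp only [add_tmul, map_add, hx, hy]; simp [F, add_mul]
  have hG (s : H ⊗[K] H) : TensorProduct.lid K H (LinearMap.rTensor H (f ∘ₗ mulAntipodeRight K H)
      ((TensorProduct.assoc K H H H).symm (u ⊗ₜ s))) = tmulMap G LinearMap.id s := by
    induction s with
    | zero => simp
    | tmul x y => simp [G, Algebra.smul_def]
    | add x y hx hy => simp only [tmul_add, map_add, hx, hy]
  have hFS (t s : H ⊗[K] H) : TensorProduct.rid K H (LinearMap.lTensor H f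
      (t * tmulMap (iR.toLinearMap ∘ₗ HopfAlgebra.antipode K)
        (iL.toLinearMap ∘ₗ HopfAlgebra.antipode K) s)) =
      tmulMap (F t) (HopfAlgebra.antipode K) s := by
    induction s with
    | zero => simp
    | add x y hx hy => simp only [map_add, mul_add, hx, hy]
    | tmul x y =>
      induction t with
      | zero => simp [F]
      | add x y hx hy =>
        simp only [add_mul, map_add, hx, hy]
        simp [F, add_mul]
      | tmul a b => simp [F, iR, iL]
  have h : convolve (F (Coalgebra.comul u)) (HopfAlgebra.antipode K) = G := by
    refine LinearMap.ext fun w => ?_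
    rw [convolve_apply, ← hFS, ← convolve_apply, ← comul_comp_antipode, LinearMap.comp_apply,
      ← Bialgebra.comul_mul, ← rightHit_apply, hf]
    simp [G, Algebra.smul_def]
  have hFG : F (Coalgebra.comul u) = convolve G LinearMap.id := by
    rw [← h, convolve_assoc, convolve_antipode_id, convolve_convUnit]
  simp only [LinearMap.comp_apply, LinearMap.rTensor_tmul, LinearMap.lTensor_tmul,
    LinearEquiv.coe_coe, hF, hG, hFG, convolve_apply]

variable {R : H ⊗[K] H} {γ : H ⊗[K] H →ₗ[K] K}

lemma IsQuasiTriangular.surjective_twist (hR : IsQuasiTriangular K H R) :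
    Function.Surjective (twist R) := by
  obtain ⟨u, rfl⟩ := hR.isUnit
  refine fun t => ⟨twist (u⁻¹ : (H ⊗[K] H)ˣ) t, ?_⟩
  rw [← Module.End.mul_apply, ← twist_mul, Units.mul_inv, twist_one, Module.End.one_apply]

lemma IsQuasiTriangular.exists_comp_twist (hR : IsQuasiTriangular K H R)
    (g : H ⊗[K] H →ₗ[K] K) : ∃ γ : H ⊗[K] H →ₗ[K] K, γ ∘ₗ twist R = g := by
  obtain ⟨u, rfl⟩ := hR.isUnit
  refine ⟨g ∘ₗ twist (u⁻¹ : (H ⊗[K] H)ˣ), ?_⟩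
  rw [LinearMap.comp_assoc, ← Module.End.mul_eq_comp, ← twist_mul, Units.inv_mul, twist_one]
  rfl

lemma IsQuasiTriangular.comp_diagAction (hR : IsQuasiTriangular K H R)
    (hf : ∀ x, f ∘ₗ adjointAction K H x = convUnit K H (Module.End K K) x ∘ₗ f)
    (hγ : γ ∘ₗ twist R = f ∘ₗ mulAntipodeRight K H) (x : H) :
    γ ∘ₗ diagAction K H x = convUnit K H (Module.End K K) x ∘ₗ γ := by
  rw [← LinearMap.cancel_right hR.surjective_twist, LinearMap.comp_assoc,
    ← hR.twist_comp_comulAction, ← LinearMap.comp_assoc, hγ, LinearMap.comp_assoc,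
    mulAntipodeRight_comp_comulAction, ← LinearMap.comp_assoc, hf, LinearMap.comp_assoc,
    LinearMap.comp_assoc, hγ]

lemma IsQuasiTriangular.lTensor_comp_twist12_mul_twist13 (hR : IsQuasiTriangular K H R)
    (hγ : ∀ x, γ ∘ₗ diagAction K H x = convUnit K H (Module.End K K) x ∘ₗ γ) :
    LinearMap.lTensor H γ ∘ₗ (twist12 R * twist13 R) = LinearMap.lTensor H γ := by
  have h (x : H) : LinearMap.lTensor H γ ∘ₗ
      convolve (actRight H (actLeft H (adjointAction K H))).toLinearMap
        (actRight H (actRight H (adjointAction K H))).toLinearMap x =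
      convUnit K H (Module.End K (H ⊗[K] K)) x ∘ₗ LinearMap.lTensor H γ := by
    rw [← lTensor_convolve, ← diagAction, ← LinearMap.lTensor_comp, hγ, LinearMap.lTensor_comp]
    congr 1
    ext
    simp [convUnit_apply, ← TensorProduct.tmul_smul]
  rw [← hR.tmulMap_diag, comp_tmulMap h (B' := (actLeft K (mulAntipode K H)).toLinearMap)
    fun y => comp_lTensor_commute _ _, hR.tmulMap_convUnit_left]
  rfl

lemma IsQuasiTriangular.rTensor_comp_twist13_mul_twist23 (hR : IsQuasiTriangular K H R)
    {g : H ⊗[K] H →ₗ[K] K}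
    (hg : ∀ y, g ∘ₗ convolve (actRight H (mulAntipode K H)).toLinearMap
      (actLeft H (mulAntipode K H)).toLinearMap y = convUnit K H (Module.End K K) y ∘ₗ g) :
    (LinearMap.rTensor H g ∘ₗ (TensorProduct.assoc K H H H).symm.toLinearMap) ∘ₗ
        (twist13 R * twist23 R) =
      LinearMap.rTensor H g ∘ₗ (TensorProduct.assoc K H H H).symm.toLinearMap := by
  have h := hR.tmulMap_convolve_right
    (A := actRight H (actRight H (adjointAction K H)))
    (B := actRight H (actLeft H (mulAntipode K H)))
    (C := actLeft (H ⊗[K] H) (mulAntipode K H))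
    (fun x y => (commute_actRight_actLeft _ _ x y).actRight)
    (commute_actRight_actLeft _ _) (commute_actRight_actLeft _ _)
  have hsymm (y : H) : (TensorProduct.assoc K H H H).symm.toLinearMap ∘ₗ
      convolve (actRight H (actLeft H (mulAntipode K H))).toLinearMap
        (actLeft (H ⊗[K] H) (mulAntipode K H)).toLinearMap y =
      LinearMap.rTensor H (convolve (actRight H (mulAntipode K H)).toLinearMap
        (actLeft H (mulAntipode K H)).toLinearMap y) ∘ₗ
        (TensorProduct.assoc K H H H).symm.toLinearMap := by
    rw [convolve_apply, convolve_apply, rTensor_tmulMap]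
    refine comp_tmulMap (fun x => ?_) (fun x => ?_) _ <;>
    · refine TensorProduct.ext' fun a t => ?_
      induction t with
      | zero => simp
      | tmul b c => rfl
      | add s t hs ht => simp only [tmul_add, map_add, hs, ht]
  have hA (x : H) : (LinearMap.rTensor H g ∘ₗ (TensorProduct.assoc K H H H).symm.toLinearMap) ∘ₗ
      (actRight H (actRight H (adjointAction K H))).toLinearMap x =
      (actRight K (adjointAction K H)).toLinearMap x ∘ₗ
        (LinearMap.rTensor H g ∘ₗ (TensorProduct.assoc K H H H).symm.toLinearMap) := by
    refine TensorProduct.ext' fun a t => ?_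
    induction t with
    | zero => simp
    | tmul b c => rfl
    | add s t hs ht => simp only [tmul_add, map_add, hs, ht]
  have hB (y : H) : (LinearMap.rTensor H g ∘ₗ (TensorProduct.assoc K H H H).symm.toLinearMap) ∘ₗ
      convolve (actRight H (actLeft H (mulAntipode K H))).toLinearMap
        (actLeft (H ⊗[K] H) (mulAntipode K H)).toLinearMap y =
      convUnit K H (Module.End K (K ⊗[K] H)) y ∘ₗ
        (LinearMap.rTensor H g ∘ₗ (TensorProduct.assoc K H H H).symm.toLinearMap) := by
    rw [LinearMap.comp_assoc, hsymm, ← LinearMap.comp_assoc, ← LinearMap.rTensor_comp, hg,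
      LinearMap.rTensor_comp, LinearMap.comp_assoc]
    congr 1
  rw [twist13, twist23, ← h, comp_tmulMap hA hB, hR.tmulMap_convUnit_right]
  rfl

/-- The transmuted coalgebra is coseparable as soon as `f` is an invariant integral. -/
lemma IsQuasiTriangular.coseparable_deltaR (hR : IsQuasiTriangular K H R)
    (hfr : ∀ h, rightHit (Coalgebra.comul (R := K)) f h = f h • (1 : H))
    (hf : ∀ x, f ∘ₗ adjointAction K H x = convUnit K H (Module.End K K) x ∘ₗ f)
    (hγ : γ ∘ₗ twist R = f ∘ₗ mulAntipodeRight K H) (t : H ⊗[K] H) :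
    TensorProduct.rid K H (LinearMap.lTensor H γ
        (TensorProduct.assoc K H H H (LinearMap.rTensor H (deltaR K H R) t))) =
      TensorProduct.lid K H (LinearMap.rTensor H γ
        ((TensorProduct.assoc K H H H).symm (LinearMap.lTensor H (deltaR K H R) t))) := by
  obtain ⟨t, rfl⟩ := hR.surjective_twist t
  have hg (y : H) : (f ∘ₗ mulAntipodeRight K H) ∘ₗ
      convolve (actRight H (mulAntipode K H)).toLinearMap
        (actLeft H (mulAntipode K H)).toLinearMap y =
      convUnit K H (Module.End K K) y ∘ₗ f ∘ₗ mulAntipodeRight K H := by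
    rw [LinearMap.comp_assoc, mulAntipodeRight_comp_convolve, ← LinearMap.comp_assoc,
      comp_convUnit, LinearMap.comp_assoc]
  have h1 := LinearMap.congr_fun hR.assoc_rTensor_deltaR_comp_twist t
  have h2 := LinearMap.congr_fun hR.lTensor_deltaR_comp_twist' t
  have h3 := LinearMap.congr_fun
    (hR.lTensor_comp_twist12_mul_twist13 (hR.comp_diagAction hf hγ))
  have h4 := LinearMap.congr_fun (hR.rTensor_comp_twist13_mul_twist23 hg)
  have h5 := LinearMap.congr_fun (coseparable_comul hfr) t
  have h6 (s : H ⊗[K] (H ⊗[K] H)) : LinearMap.lTensor H γ (twist23 R s) =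
      LinearMap.lTensor H (f ∘ₗ mulAntipodeRight K H) s := by
    rw [← lTensor_twist, ← LinearMap.comp_apply, ← LinearMap.lTensor_comp, hγ]
  have h7 (s : H ⊗[K] (H ⊗[K] H)) :
      LinearMap.rTensor H γ ((TensorProduct.assoc K H H H).symm (twist12 R s)) =
      LinearMap.rTensor H (f ∘ₗ mulAntipodeRight K H) ((TensorProduct.assoc K H H H).symm s) := by
    obtain ⟨s, rfl⟩ := (TensorProduct.assoc K H H H).surjective s
    have := LinearMap.congr_fun (assoc_comp_rTensor_twist R) s
    simp only [LinearMap.comp_apply, LinearEquiv.coe_coe] at this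
    rw [← this, LinearEquiv.symm_apply_apply, LinearEquiv.symm_apply_apply,
      ← LinearMap.comp_apply, ← LinearMap.rTensor_comp, hγ]
  simp only [LinearMap.comp_apply, LinearEquiv.coe_coe, Module.End.mul_apply] at h1 h2 h3 h4 h5
  rw [h1, h2, h3, h6, h7, h4, h5]

lemma comp_deltaR_eq_counit (hf1 : f 1 = 1)
    (hγ : γ ∘ₗ twist R = f ∘ₗ mulAntipodeRight K H) (c : H) :
    γ (deltaR K H R c) = Coalgebra.counit (R := K) c := by
  rw [deltaR_eq, ← LinearMap.comp_apply, ← LinearMap.comp_assoc, hγ]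
  simp only [LinearMap.comp_apply, mulAntipodeRight, HopfAlgebra.mul_antipode_lTensor_comul_apply]
  rw [Algebra.algebraMap_eq_smul_one, map_smul, hf1, smul_eq_mul, mul_one]

end Coseparability

/-- Let `(H,R)` be a finite dimensional semisimple and cosemisimple
quasi-triangular Hopf algebra over a field `k`.  Then the transmuted braided group
`H_R` is a cosemisimple `k`-coalgebra. -/
theorem transmuted_braided_group_cosemisimple [FiniteDimensional K H]
    (R : H ⊗[K] H) (hR : IsQuasiTriangular K H R)
    (hss : IsSemisimpleRing H)
    (hcoss : IsCosemisimpleCoalgebra K H) :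
    IsCosemisimpleR K H R := by
  obtain ⟨f, hf1, hfl, hfr⟩ := hcoss.exists_integral
  obtain ⟨Λ, hΛ1, hl, hr⟩ := exists_integral (K := K) hss
  have hf := integral_comp_adjointAction
    (integral_mul_antipode hfl hfr hl hr (integral_apply_ne_zero hf1 hfr hΛ1 hl))
  obtain ⟨γ, hγ⟩ := hR.exists_comp_twist (f ∘ₗ mulAntipodeRight K H)
  simpa only [IsCosemisimpleR, isSimpleSubcoalgebraR_iff] using
    sSup_simpleHitStable_eq_top_of_coseparable (deltaR K H R) Coalgebra.counit
      hR.leftHit_deltaR_counit hR.rightHit_deltaR_counit hR.deltaR_coassoc γ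
      (comp_deltaR_eq_counit hf1 hγ) (hR.coseparable_deltaR hfr hf hγ)
end
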